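/- arXiv:1711.04747 — 7 statements merged into one kernel-verified Lean document; each statement's English description precedes it below -/
import Mathlib

section
/- For every sequence λ = (λ_n)_{n≥0} of elements of K, every function h from words to K with h(ε) = λ_0 that satisfies the global recurrences for λ is a solution of the matrix ansatz system for λ. -/
open MvPolynomial Finset

noncomputable section

/-- The polynomial ring `ℚ[α,β,γ,δ,q,u]`: variables `0,1,2,3,4,5` are `α,β,γ,δ,q,u`. -/
abbrev P6 : Type := MvPolynomial (Fin 6) ℚ

/-- The field of rational functions `ℚ(α,β,γ,δ,q,u)`. -/
abbrev K6 : Type := FractionRing P6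

def va : K6 := algebraMap P6 K6 (X 0)  -- α
def vb : K6 := algebraMap P6 K6 (X 1)  -- β
def vg : K6 := algebraMap P6 K6 (X 2)  -- γ
def vd : K6 := algebraMap P6 K6 (X 3)  -- δ
def vq : K6 := algebraMap P6 K6 (X 4)  -- q
def vu : K6 := algebraMap P6 K6 (X 5)  -- u

/-- Words over `{•,∘}` are lists of booleans, `true` = `•` and `false` = `∘`;
the head of the list is the leftmost letter of the word. -/
def IsSolution (lam : ℕ → K6) (g : List Bool → K6) : Prop :=
  (∀ Xl Yl : List Bool,
      vu * g (Xl ++ true :: false :: Yl) =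
        vq * g (Xl ++ false :: true :: Yl) +
          lam (Xl.length + Yl.length + 2) * (g (Xl ++ true :: Yl) + g (Xl ++ false :: Yl))) ∧
  (∀ Xl : List Bool, va * g (false :: Xl) = vg * g (true :: Xl) + lam (Xl.length + 1) * g Xl) ∧
  (∀ Xl : List Bool, vb * g (Xl ++ [true]) = vd * g (Xl ++ [false]) + lam (Xl.length + 1) * g Xl) ∧
  g [] = lam 0

/-- `Σ_{X = U•V} u^{n−1−|∘(U)|−|V|} q^{|∘(U)|+|V|} (g(U•V)+g(U∘V))`, the sum being over all
decompositions of `X` as a concatenation `U•V`. -/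
def sumBlack (g : List Bool → K6) (Xl : List Bool) : K6 :=
  ∑ i : Fin Xl.length,
    if Xl.get i = true then
      vu ^ (Xl.length - 1 - (Xl.take i.val).count false - (Xl.drop (i.val + 1)).length) *
        vq ^ ((Xl.take i.val).count false + (Xl.drop (i.val + 1)).length) *
        (g (Xl.take i.val ++ true :: Xl.drop (i.val + 1)) +
          g (Xl.take i.val ++ false :: Xl.drop (i.val + 1)))
    else 0

/-- `Σ_{X = U∘V} u^{n−1−|∘(U)|} q^{|∘(U)|} (g(U•V)+g(U∘V))`, the sum being over all
decompositions of `X` as a concatenation `U∘V`. -/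
def sumWhite (g : List Bool → K6) (Xl : List Bool) : K6 :=
  ∑ i : Fin Xl.length,
    if Xl.get i = false then
      vu ^ (Xl.length - 1 - (Xl.take i.val).count false) *
        vq ^ ((Xl.take i.val).count false) *
        (g (Xl.take i.val ++ true :: Xl.drop (i.val + 1)) +
          g (Xl.take i.val ++ false :: Xl.drop (i.val + 1)))
    else 0

/-- The global recurrence (2.2), computing `h(•X)`. -/
def GlobalRecBlack (lam : ℕ → K6) (h : List Bool → K6) : Prop :=
  ∀ Xl : List Bool,
    h (true :: Xl) =
      lam (Xl.length + 1) / (vu ^ Xl.length * va * vb - vq ^ Xl.length * vg * vd) *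
        (va * vd * sumBlack h Xl + vq ^ Xl.length * vd * h Xl +
          vu ^ (Xl.length - Xl.count false) * vq ^ (Xl.count false) * va * h Xl +
          va * vb * sumWhite h Xl)

/-- The global recurrence (2.3), computing `h(∘X)`. -/
def GlobalRecWhite (lam : ℕ → K6) (h : List Bool → K6) : Prop :=
  ∀ Xl : List Bool,
    h (false :: Xl) =
      lam (Xl.length + 1) / (vu ^ Xl.length * va * vb - vq ^ Xl.length * vg * vd) *
        (vg * vd * sumBlack h Xl +
          vu ^ (Xl.length - Xl.count false) * vq ^ (Xl.count false) * vg * h Xl +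
          vg * vb * sumWhite h Xl + vu ^ Xl.length * vb * h Xl)

section MatrixAnsatz

variable {K : Type*} [Field K]

/-- The weight `u ^ |•(X)| * q ^ |∘(X)|` of a word `X`. -/
def wordWeight (u q : K) : List Bool → K
  | [] => 1
  | true :: Y => u * wordWeight u q Y
  | false :: Y => q * wordWeight u q Y

/-- Recursive form of the weighted sum over the decompositions `X = U•V`. -/
def blackSum (u q : K) : List Bool → (List Bool → K) → K
  | [], _ => 0
  | true :: Y, g =>
      q ^ Y.length * (g (true :: Y) + g (false :: Y)) +
        u * blackSum u q Y (fun w => g (true :: w))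
  | false :: Y, g => q * blackSum u q Y (fun w => g (false :: w))

/-- Recursive form of the weighted sum over the decompositions `X = U∘V`. -/
def whiteSum (u q : K) : List Bool → (List Bool → K) → K
  | [], _ => 0
  | true :: Y, g => u * whiteSum u q Y (fun w => g (true :: w))
  | false :: Y, g =>
      u ^ Y.length * (g (true :: Y) + g (false :: Y)) +
        q * whiteSum u q Y (fun w => g (false :: w))

theorem wordWeight_append (u q : K) (X Y : List Bool) :
    wordWeight u q (X ++ Y) = wordWeight u q X * wordWeight u q Y := by
  induction X with
  | nil => simp [wordWeight]
  | cons x X ih => cases x <;> simp [wordWeight, ih, mul_assoc]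

theorem wordWeight_eq (u q : K) (X : List Bool) :
    wordWeight u q X = u ^ (X.length - X.count false) * q ^ X.count false := by
  induction X with
  | nil => simp [wordWeight]
  | cons x X ih =>
    have := List.count_le_length (a := false) (l := X)
    cases x
    · simp [wordWeight, ih, pow_succ]; ring
    · simp [wordWeight, ih, Nat.succ_sub this, pow_succ]; ring

theorem blackSum_append (u q : K) (X Y : List Bool) (g : List Bool → K) :
    blackSum u q (X ++ Y) g =
      q ^ Y.length * blackSum u q X (fun w => g (w ++ Y)) +
        wordWeight u q X * blackSum u q Y (fun w => g (X ++ w)) := by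
  induction X generalizing g with
  | nil => simp [wordWeight, blackSum]
  | cons x X ih => cases x <;> simp [wordWeight, blackSum, ih, pow_add] <;> ring

theorem whiteSum_append (u q : K) (X Y : List Bool) (g : List Bool → K) :
    whiteSum u q (X ++ Y) g =
      u ^ Y.length * whiteSum u q X (fun w => g (w ++ Y)) +
        wordWeight u q X * whiteSum u q Y (fun w => g (X ++ w)) := by
  induction X generalizing g with
  | nil => simp [wordWeight, whiteSum]
  | cons x X ih => cases x <;> simp [wordWeight, whiteSum, ih, pow_add] <;> ring

theorem blackSum_add (u q : K) (X : List Bool) (f g : List Bool → K) :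
    blackSum u q X (fun w => f w + g w) = blackSum u q X f + blackSum u q X g := by
  induction X generalizing f g with
  | nil => simp [blackSum]
  | cons x X ih =>
    cases x
    · simp only [blackSum, ih (fun w => f (false :: w)) (fun w => g (false :: w))]; ring
    · simp only [blackSum, ih (fun w => f (true :: w)) (fun w => g (true :: w))]; ring

theorem whiteSum_add (u q : K) (X : List Bool) (f g : List Bool → K) :
    whiteSum u q X (fun w => f w + g w) = whiteSum u q X f + whiteSum u q X g := by
  induction X generalizing f g with
  | nil => simp [whiteSum]
  | cons x X ih =>
    cases x
    · simp only [whiteSum, ih (fun w => f (false :: w)) (fun w => g (false :: w))]; ring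
    · simp only [whiteSum, ih (fun w => f (true :: w)) (fun w => g (true :: w))]; ring

theorem blackSum_linear (u q a b c : K) (X : List Bool) (f g k : List Bool → K)
    (H : ∀ w : List Bool, w.length = X.length → a * f w = b * g w + c * k w) :
    a * blackSum u q X f = b * blackSum u q X g + c * blackSum u q X k := by
  induction X generalizing f g k with
  | nil => simp [blackSum]
  | cons x X ih =>
    cases x
    · have e := ih (fun w => f (false :: w)) (fun w => g (false :: w)) (fun w => k (false :: w))
        fun w hw => H _ (by simp [hw])
      simp only [blackSum]
      linear_combination q * e
    · have e := ih (fun w => f (true :: w)) (fun w => g (true :: w)) (fun w => k (true :: w))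
        fun w hw => H _ (by simp [hw])
      simp only [blackSum]
      linear_combination u * e +
        q ^ X.length * (H (true :: X) (by simp) + H (false :: X) (by simp))

theorem whiteSum_linear (u q a b c : K) (X : List Bool) (f g k : List Bool → K)
    (H : ∀ w : List Bool, w.length = X.length → a * f w = b * g w + c * k w) :
    a * whiteSum u q X f = b * whiteSum u q X g + c * whiteSum u q X k := by
  induction X generalizing f g k with
  | nil => simp [whiteSum]
  | cons x X ih =>
    cases x
    · have e := ih (fun w => f (false :: w)) (fun w => g (false :: w)) (fun w => k (false :: w))
        fun w hw => H _ (by simp [hw])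
      simp only [whiteSum]
      linear_combination q * e +
        u ^ X.length * (H (true :: X) (by simp) + H (false :: X) (by simp))
    · have e := ih (fun w => f (true :: w)) (fun w => g (true :: w)) (fun w => k (true :: w))
        fun w hw => H _ (by simp [hw])
      simp only [whiteSum]
      linear_combination u * e

/-- Moving a `•` from the left end of a word to its right end. -/
theorem pow_mul_black_cons (u q c : K) (Y : List Bool) (g : List Bool → K)
    (H : ∀ U V : List Bool, U.length + V.length + 1 = Y.length →
      u * g (U ++ true :: false :: V) =
        q * g (U ++ false :: true :: V) + c * (g (U ++ true :: V) + g (U ++ false :: V))) :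
    u ^ Y.length * g (true :: Y) =
      wordWeight u q Y * g (Y ++ [true]) + c * whiteSum u q Y g := by
  induction Y generalizing g with
  | nil => simp [wordWeight, whiteSum]
  | cons y Y ih =>
    have e := ih (fun w => g (y :: w)) fun U V hUV => by
      have := H (y :: U) V (by simp; omega)
      simpa using this
    cases y
    · have e' := H [] Y (by simp)
      simp only [List.nil_append] at e'
      simp only [wordWeight, whiteSum, List.length_cons, List.cons_append, pow_succ]
      linear_combination q * e + u ^ Y.length * e'
    · simp only [wordWeight, whiteSum, List.length_cons, List.cons_append, pow_succ]
      linear_combination u * e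

/-- Moving a `∘` from the left end of a word to its right end. -/
theorem pow_mul_white_cons (u q c : K) (Y : List Bool) (g : List Bool → K)
    (H : ∀ U V : List Bool, U.length + V.length + 1 = Y.length →
      u * g (U ++ true :: false :: V) =
        q * g (U ++ false :: true :: V) + c * (g (U ++ true :: V) + g (U ++ false :: V))) :
    q ^ Y.length * g (false :: Y) =
      wordWeight u q Y * g (Y ++ [false]) - c * blackSum u q Y g := by
  induction Y generalizing g with
  | nil => simp [wordWeight, blackSum]
  | cons y Y ih =>
    have e := ih (fun w => g (y :: w)) fun U V hUV => by
      have := H (y :: U) V (by simp; omega)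
      simpa using this
    cases y
    · simp only [wordWeight, blackSum, List.length_cons, List.cons_append, pow_succ]
      linear_combination q * e
    · have e' := H [] Y (by simp)
      simp only [List.nil_append] at e'
      simp only [wordWeight, blackSum, List.length_cons, List.cons_append, pow_succ]
      linear_combination u * e - q ^ Y.length * e'

/-- The common part of the two global recurrences. -/
def transferSum (b d u q : K) (h : List Bool → K) (X : List Bool) : K :=
  d * blackSum u q X h + wordWeight u q X * h X + b * whiteSum u q X h

/-- The exchange relation and the right boundary relation on words of length `N`. -/
def AnsatzAt (b d u q : K) (lam : ℕ → K) (h : List Bool → K) (N : ℕ) : Prop :=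
  (∀ X Y : List Bool, X.length + Y.length + 2 = N →
    u * h (X ++ true :: false :: Y) =
      q * h (X ++ false :: true :: Y) + lam N * (h (X ++ true :: Y) + h (X ++ false :: Y))) ∧
  ∀ X : List Bool, X.length + 1 = N →
    b * h (X ++ [true]) = d * h (X ++ [false]) + lam N * h X

theorem eq_zero_of_two_relations {a b c d D x y : K} (hD : a * d - b * c = D) (h0 : D ≠ 0)
    (h1 : a * x + b * y = 0) (h2 : c * x + d * y = 0) : x = 0 ∧ y = 0 := by
  subst hD
  constructor
  · exact (mul_eq_zero.mp (by linear_combination d * h1 - b * h2 :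
      (a * d - b * c) * x = 0)).resolve_left h0
  · exact (mul_eq_zero.mp (by linear_combination a * h2 - c * h1 :
      (a * d - b * c) * y = 0)).resolve_left h0

variable {a b c d u q : K} {lam : ℕ → K} {h : List Bool → K}

theorem transferSum_exchange (X Y : List Bool)
    (ih : AnsatzAt b d u q lam h (X.length + Y.length + 2)) :
    u * transferSum b d u q h (X ++ true :: false :: Y) -
        q * transferSum b d u q h (X ++ false :: true :: Y) =
      u ^ (X.length + Y.length + 2) * b *
        (h (true :: (X ++ true :: Y)) + h (true :: (X ++ false :: Y))) -
      q ^ (X.length + Y.length + 2) * d *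
        (h (false :: (X ++ true :: Y)) + h (false :: (X ++ false :: Y))) := by
  obtain ⟨ih1, ih2⟩ := ih
  have E := ih1 X Y rfl
  generalize lam (X.length + Y.length + 2) = l at ih1 ih2 E
  have P1 := fun x => pow_mul_black_cons u q l (X ++ x :: Y) h fun U V hUV =>
    ih1 U V (by simp at hUV; omega)
  have Q1 := fun x => pow_mul_white_cons u q l (X ++ x :: Y) h fun U V hUV =>
    ih1 U V (by simp at hUV; omega)
  have P2 := pow_mul_black_cons u q l Y (fun w => h (X ++ true :: w)) fun U V hUV => by
    simpa using ih1 (X ++ true :: U) V (by simp; omega)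
  have Q2 := pow_mul_white_cons u q l Y (fun w => h (X ++ false :: w)) fun U V hUV => by
    simpa using ih1 (X ++ false :: U) V (by simp; omega)
  have R := fun x => ih2 (X ++ x :: Y) (by simp; omega)
  have B1 := blackSum_linear u q u q l X (fun w => h (w ++ true :: false :: Y))
    (fun w => h (w ++ false :: true :: Y)) (fun w => h (w ++ true :: Y) + h (w ++ false :: Y))
    fun w hw => ih1 w Y (by omega)
  have W1 := whiteSum_linear u q u q l X (fun w => h (w ++ true :: false :: Y))
    (fun w => h (w ++ false :: true :: Y)) (fun w => h (w ++ true :: Y) + h (w ++ false :: Y))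
    fun w hw => ih1 w Y (by omega)
  have B2 := blackSum_linear u q u q l Y (fun w => h (X ++ true :: false :: w))
    (fun w => h (X ++ false :: true :: w)) (fun w => h (X ++ true :: w) + h (X ++ false :: w))
    fun w hw => ih1 X w (by omega)
  have W2 := whiteSum_linear u q u q l Y (fun w => h (X ++ true :: false :: w))
    (fun w => h (X ++ false :: true :: w)) (fun w => h (X ++ true :: w) + h (X ++ false :: w))
    fun w hw => ih1 X w (by omega)
  rw [blackSum_add] at B1 B2
  rw [whiteSum_add] at W1 W2
  have hp := P1 true
  have hp' := P1 false
  have hq := Q1 true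
  have hq' := Q1 false
  have hr := R true
  have hr' := R false
  simp only [transferSum, blackSum_append, whiteSum_append, wordWeight_append, blackSum, whiteSum,
    wordWeight, List.length_cons, List.length_append, List.append_assoc, List.cons_append]
    at hp hp' hq hq' hr hr' ⊢
  linear_combination d * q ^ (Y.length + 2) * B1 + b * u ^ (Y.length + 2) * W1 +
    wordWeight u q X * u * q * (d * B2 + b * W2) +
    wordWeight u q X * u * q * wordWeight u q Y * (E - hr - hr') - b * u * (hp + hp') +
    d * q * (hq + hq') + wordWeight u q X * (b * u ^ (Y.length + 1) + d * q ^ (Y.length + 1)) * E +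
    (u - q) * wordWeight u q X * (q * d * Q2 + u * b * P2)

theorem transferSum_boundary (X : List Bool) (ih : AnsatzAt b d u q lam h (X.length + 1)) :
    b * transferSum b d u q h (X ++ [true]) - d * transferSum b d u q h (X ++ [false]) =
      u ^ (X.length + 1) * b * h (true :: X) - q ^ (X.length + 1) * d * h (false :: X) := by
  obtain ⟨ih1, ih2⟩ := ih
  have P := pow_mul_black_cons u q (lam (X.length + 1)) X h fun U V hUV =>
    ih1 U V (by omega)
  have Q := pow_mul_white_cons u q (lam (X.length + 1)) X h fun U V hUV =>
    ih1 U V (by omega)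
  have B := blackSum_linear u q b d (lam (X.length + 1)) X (fun w => h (w ++ [true]))
    (fun w => h (w ++ [false])) h fun w hw => ih2 w (by omega)
  have W := whiteSum_linear u q b d (lam (X.length + 1)) X (fun w => h (w ++ [true]))
    (fun w => h (w ++ [false])) h fun w hw => ih2 w (by omega)
  simp only [transferSum, blackSum_append, whiteSum_append, wordWeight_append, blackSum, whiteSum,
    wordWeight, List.length_cons, List.length_nil, pow_zero, zero_add, pow_succ]
  linear_combination d * q * B + b * u * W - b * u * P + d * q * Q

theorem ansatzAt_of_transfer (hD : ∀ n : ℕ, u ^ n * a * b - q ^ n * c * d ≠ 0)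
    (hII : ∀ X : List Bool, a * h (false :: X) = c * h (true :: X) + lam (X.length + 1) * h X)
    (hR : ∀ X : List Bool, u ^ X.length * b * h (true :: X) - q ^ X.length * d * h (false :: X) =
      lam (X.length + 1) * transferSum b d u q h X) (N : ℕ) :
    AnsatzAt b d u q lam h N := by
  induction N with
  | zero => exact ⟨fun X Y hN => by omega, fun X hN => by omega⟩
  | succ k ih =>
    constructor
    · rintro (_ | ⟨x, X⟩) Y hN
      · obtain rfl : Y.length + 1 = k := by simpa using hN
        have hB := blackSum_linear u q a c (lam (Y.length + 1)) Y (fun w => h (false :: w))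
          (fun w => h (true :: w)) h fun w hw => hw ▸ hII w
        have hW := whiteSum_linear u q a c (lam (Y.length + 1)) Y (fun w => h (false :: w))
          (fun w => h (true :: w)) h fun w hw => hw ▸ hII w
        have h1 := hR (false :: Y)
        have h2 := hR (true :: Y)
        have h3 := hII (false :: Y)
        have h4 := hII (true :: Y)
        have h5 := hR Y
        have h6 := hII Y
        refine mul_left_cancel₀ (hD (Y.length + 1)) ?_
        simp only [transferSum, blackSum, whiteSum, wordWeight, List.length_cons, pow_succ,
          List.nil_append] at h1 h2 h3 h4 h5 h6 hB hW ⊢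
        linear_combination u * (a * h1 + q ^ (Y.length + 1) * d * h3) -
          q * (c * h2 + u ^ (Y.length + 1) * b * h4) +
          lam (Y.length + 1 + 1) * u * q * (d * hB + b * hW + wordWeight u q Y * h6 - h5)
      · obtain rfl : X.length + Y.length + 2 = k := by simp at hN; omega
        have hS := transferSum_exchange X Y ih
        have hI := ih.1 X Y rfl
        have h1 := hR (X ++ true :: false :: Y)
        have h2 := hR (X ++ false :: true :: Y)
        have h3 := hII (X ++ true :: false :: Y)
        have h4 := hII (X ++ false :: true :: Y)
        have h5 := hII (X ++ true :: Y)
        have h6 := hII (X ++ false :: Y)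
        have l1 : (X ++ true :: false :: Y).length = X.length + Y.length + 2 := by simp; omega
        have l2 : (X ++ false :: true :: Y).length = X.length + Y.length + 2 := by simp; omega
        have l3 : (X ++ true :: Y).length + 1 = X.length + Y.length + 2 := by simp; omega
        have l4 : (X ++ false :: Y).length + 1 = X.length + Y.length + 2 := by simp; omega
        rw [l1] at h1 h3
        rw [l2] at h2 h4
        rw [l3] at h5
        rw [l4] at h6
        generalize X.length + Y.length + 2 = k at *
        let T : Bool → K := fun x => u * h (x :: (X ++ true :: false :: Y)) -
          q * h (x :: (X ++ false :: true :: Y)) -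
          lam (k + 1) * (h (x :: (X ++ true :: Y)) + h (x :: (X ++ false :: Y)))
        have key : T true = 0 ∧ T false = 0 := by
          refine eq_zero_of_two_relations (a := u ^ k * b) (b := -(q ^ k * d)) (c := -c) (d := a)
            (D := u ^ k * a * b - q ^ k * c * d) (by ring) (hD k) ?_ ?_
          · linear_combination u * h1 - q * h2 + lam (k + 1) * hS
          · linear_combination u * h3 - q * h4 + lam (k + 1) * hI - lam (k + 1) * (h5 + h6)
        have : T x = 0 := by cases x; exacts [key.2, key.1]
        simp only [List.cons_append]
        linear_combination this
    · rintro (_ | ⟨x, X⟩) hN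
      · obtain rfl : k = 0 := by simpa using hN.symm
        have := hR []
        simp [transferSum, blackSum, whiteSum, wordWeight] at this ⊢
        linear_combination this
      · obtain rfl : X.length + 1 = k := by simpa using hN
        have hS := transferSum_boundary X ih
        have hI := ih.2 X rfl
        have h1 := hR (X ++ [true])
        have h2 := hR (X ++ [false])
        have h3 := hII (X ++ [true])
        have h4 := hII (X ++ [false])
        have h5 := hII X
        rw [List.length_append, List.length_singleton] at h1 h2 h3 h4
        generalize X.length + 1 = k at *
        let T : Bool → K := fun x => b * h (x :: (X ++ [true])) - d * h (x :: (X ++ [false])) -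
          lam (k + 1) * h (x :: X)
        have key : T true = 0 ∧ T false = 0 := by
          refine eq_zero_of_two_relations (a := u ^ k * b) (b := -(q ^ k * d)) (c := -c) (d := a)
            (D := u ^ k * a * b - q ^ k * c * d) (by ring) (hD k) ?_ ?_
          · linear_combination b * h1 - d * h2 + lam (k + 1) * hS
          · linear_combination b * h3 - d * h4 + lam (k + 1) * hI - lam (k + 1) * h5
        have : T x = 0 := by cases x; exacts [key.2, key.1]
        simp only [List.cons_append]
        linear_combination this

end MatrixAnsatz

theorem sumBlack_eq_blackSum (g : List Bool → K6) (X : List Bool) :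
    sumBlack g X = blackSum vu vq X g := by
  induction X generalizing g with
  | nil => simp [sumBlack, blackSum]
  | cons x X ih =>
    have e := ih (fun w => g (x :: w))
    unfold sumBlack at e ⊢
    refine (Fin.sum_univ_succ (n := X.length) _).trans ?_
    have le (i : Fin X.length) : (X.take i.val).count false ≤ i.val :=
      List.count_le_length.trans (by simp)
    cases x
    · simp only [blackSum, ← e, Finset.mul_sum]
      simp
      refine Finset.sum_congr rfl fun i _ => ?_
      split_ifs
      · have := le i
        have := i.2
        rw [show X.length - (List.count false (X.take i) + 1) - (X.length - (i + 1)) =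
          X.length - 1 - List.count false (X.take i) - (X.length - (i + 1)) by omega,
          show List.count false (X.take i) + 1 + (X.length - (i + 1)) =
          List.count false (X.take i) + (X.length - (i + 1)) + 1 by omega]
        ring
      · rfl
    · simp only [blackSum, ← e, Finset.mul_sum]
      simp
      refine Finset.sum_congr rfl fun i _ => ?_
      split_ifs
      · have := le i
        have := i.2
        rw [show X.length - List.count false (X.take i) - (X.length - (i + 1)) =
          X.length - 1 - List.count false (X.take i) - (X.length - (i + 1)) + 1 by omega]
        ring
      · rfl

theorem sumWhite_eq_whiteSum (g : List Bool → K6) (X : List Bool) :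
    sumWhite g X = whiteSum vu vq X g := by
  induction X generalizing g with
  | nil => simp [sumWhite, whiteSum]
  | cons x X ih =>
    have e := ih (fun w => g (x :: w))
    unfold sumWhite at e ⊢
    refine (Fin.sum_univ_succ (n := X.length) _).trans ?_
    have le (i : Fin X.length) : (X.take i.val).count false ≤ i.val :=
      List.count_le_length.trans (by simp)
    cases x
    · simp only [whiteSum, ← e, Finset.mul_sum]
      simp
      refine Finset.sum_congr rfl fun i _ => ?_
      split_ifs
      · have := le i
        have := i.2
        rw [show X.length - (List.count false (X.take i) + 1) =
          X.length - 1 - List.count false (X.take i) by omega]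
        ring
      · rfl
    · simp only [whiteSum, ← e, Finset.mul_sum]
      simp
      refine Finset.sum_congr rfl fun i _ => ?_
      split_ifs
      · have := le i
        have := i.2
        rw [show X.length - List.count false (X.take i) =
          X.length - 1 - List.count false (X.take i) + 1 by omega]
        ring
      · rfl

theorem denominator_ne_zero (n : ℕ) : vu ^ n * va * vb - vq ^ n * vg * vd ≠ 0 := by
  have hp : (X 5 ^ n * X 0 * X 1 - X 4 ^ n * X 2 * X 3 : P6) ≠ 0 := fun H => by
    have := congrArg (MvPolynomial.eval ![1, 1, 0, 0, 1, 1]) H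
    simp at this
  have := (map_ne_zero_iff (algebraMap P6 K6) (IsFractionRing.injective P6 K6)).mpr hp
  simpa only [map_sub, map_mul, map_pow, va, vb, vg, vd, vq, vu] using this

/-- every function `h` with `h(ε) = λ₀` satisfying the global recurrences for `λ`
is a solution of the matrix ansatz system for `λ`. -/
theorem statement0 (lam : ℕ → K6) (h : List Bool → K6) (h0 : h [] = lam 0)
    (hB : GlobalRecBlack lam h) (hW : GlobalRecWhite lam h) : IsSolution lam h := by
  have hB' (X : List Bool) := eq_div_iff_mul_eq (denominator_ne_zero X.length) |>.mp
    ((hB X).trans (div_mul_eq_mul_div _ _ _))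
  have hW' (X : List Bool) := eq_div_iff_mul_eq (denominator_ne_zero X.length) |>.mp
    ((hW X).trans (div_mul_eq_mul_div _ _ _))
  have hII (X : List Bool) :
      va * h (false :: X) = vg * h (true :: X) + lam (X.length + 1) * h X := by
    refine mul_left_cancel₀ (denominator_ne_zero X.length) ?_
    linear_combination va * hW' X - vg * hB' X
  have hR (X : List Bool) :
      vu ^ X.length * vb * h (true :: X) - vq ^ X.length * vd * h (false :: X) =
        lam (X.length + 1) * transferSum vb vd vu vq h X := by
    refine mul_left_cancel₀ (denominator_ne_zero X.length) ?_
    rw [transferSum, wordWeight_eq, ← sumBlack_eq_blackSum, ← sumWhite_eq_whiteSum]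
    linear_combination vu ^ X.length * vb * hB' X - vq ^ X.length * vd * hW' X
  have key := ansatzAt_of_transfer denominator_ne_zero hII hR
  exact ⟨fun X Y => (key _).1 X Y rfl, hII, fun X => (key _).2 X rfl, h0⟩
end
end

section
/- For every sequence λ = (λ_n)_{n≥0} of elements of K, every solution g of the matrix ansatz system for λ satisfies, for every word X of length n, the identity g(•X) = (λ_{n+1}/(u^n·α·β − q^n·γ·δ))·[ α·δ·Σ_{X=U•V} u^{n−1−|∘(U)|−|V|}·q^{|∘(U)|+|V|}·(g(U•V)+g(U∘V)) + q^n·δ·g(X) + u^{n−|∘(X)|}·q^{|∘(X)|}·α·g(X) + α·β·Σ_{X=U∘V} u^{n−1−|∘(U)|}·q^{|∘(U)|}·(g(U•V)+g(U∘V)) ], where the sums range over all decompositions of X as a concatenation U•V (respectively U∘V). -/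
open MvPolynomial Finset

noncomputable section

section Transport

variable {R : Type*} [CommRing R] {u q : R} {lam : ℕ → R} {g : List Bool → R}

/-- Moving a `•` from the left of `V` to its right, inside a word with prefix `U`. -/
theorem move_black_right
    (h : ∀ U V : List Bool, u * g (U ++ true :: false :: V) =
      q * g (U ++ false :: true :: V) +
        lam (U.length + V.length + 2) * (g (U ++ true :: V) + g (U ++ false :: V)))
    (U V : List Bool) :
    u ^ V.length * g (U ++ true :: V) =
      u ^ (V.length - V.count false) * q ^ V.count false * g (U ++ V ++ [true]) +
        lam (U.length + V.length + 1) * ∑ i : Fin V.length,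
          if V.get i = false then
            u ^ (V.length - 1 - (V.take i.val).count false) * q ^ (V.take i.val).count false *
              (g (U ++ (V.take i.val ++ true :: V.drop (i.val + 1))) +
                g (U ++ (V.take i.val ++ false :: V.drop (i.val + 1))))
          else 0 := by
  induction V generalizing U with
  | nil => simp
  | cons a V ih =>
    have hc : V.count false ≤ V.length := List.count_le_length
    have hi : ∀ i : Fin V.length, (V.take i.val).count false + 1 ≤ V.length := fun i => by
      have h₁ : (V.take i.val).count false ≤ (V.take i.val).length := List.count_le_length
      have h₂ := i.isLt
      rw [List.length_take] at h₁
      omega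
    have ih' := ih (U ++ [a])
    cases a
    · have h' := h U V
      rw [show (U ++ [false]).length + V.length + 1 = U.length + V.length + 2 by simp; omega] at ih'
      rw [show U.length + (false :: V).length + 1 = U.length + V.length + 2 by simp; omega]
      have hs : ∀ i : Fin V.length,
          V.length - ((V.take i.val).count false + 1) = V.length - 1 - (V.take i.val).count false :=
        fun i => by omega
      simp only [List.length_cons, Fin.sum_univ_succ, List.get_cons_zero, List.get_cons_succ',
        Fin.val_zero, Fin.val_succ, List.take_zero, List.take_succ_cons, List.drop_succ_cons,
        List.drop_zero, List.count_cons_self, List.count_nil, List.cons_append, List.nil_append,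
        List.append_assoc, if_true, Nat.add_sub_cancel, Nat.add_sub_add_right, Nat.sub_zero,
        hs] at ih' ⊢
      have key : ∀ i : Fin V.length, ∀ x : R,
          (if V.get i = false then u ^ (V.length - 1 - (V.take i.val).count false) *
            q ^ ((V.take i.val).count false + 1) * x else 0) =
          q * (if V.get i = false then u ^ (V.length - 1 - (V.take i.val).count false) *
            q ^ ((V.take i.val).count false) * x else 0) := fun i x => by
        split_ifs <;> ring
      simp only [key, ← Finset.mul_sum]
      linear_combination u ^ V.length * h' + q * ih'
    · rw [show (U ++ [true]).length + V.length + 1 = U.length + V.length + 2 by simp; omega] at ih'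
      rw [show U.length + (true :: V).length + 1 = U.length + V.length + 2 by simp; omega]
      have hs : ∀ i : Fin V.length, V.length - (V.take i.val).count false =
          (V.length - 1 - (V.take i.val).count false) + 1 := fun i => by
        have := hi i
        omega
      have hs' : V.length + 1 - V.count false = V.length - V.count false + 1 := by omega
      have ht : ∀ l : List Bool, (true :: l).count false = l.count false := by simp
      simp only [List.length_cons, Fin.sum_univ_succ, List.get_cons_zero, List.get_cons_succ',
        Fin.val_zero, Fin.val_succ, List.take_zero, List.take_succ_cons, List.drop_succ_cons,
        List.drop_zero, ht, List.cons_append, List.nil_append, Bool.true_eq_false,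
        List.append_assoc, if_false, Nat.add_sub_cancel, hs, hs', zero_add] at ih' ⊢
      have key : ∀ i : Fin V.length, ∀ x : R,
          (if V.get i = false then u ^ (V.length - 1 - (V.take i.val).count false + 1) *
            q ^ ((V.take i.val).count false) * x else 0) =
          u * (if V.get i = false then u ^ (V.length - 1 - (V.take i.val).count false) *
            q ^ ((V.take i.val).count false) * x else 0) := fun i x => by
        split_ifs <;> ring
      simp only [key, ← Finset.mul_sum]
      linear_combination u * ih'

/-- Moving a `∘` from the right of `V` to its left, inside a word with prefix `U`. -/
theorem move_white_left
    (h : ∀ U V : List Bool, u * g (U ++ true :: false :: V) =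
      q * g (U ++ false :: true :: V) +
        lam (U.length + V.length + 2) * (g (U ++ true :: V) + g (U ++ false :: V)))
    (U V : List Bool) :
    u ^ (V.length - V.count false) * q ^ V.count false * g (U ++ V ++ [false]) =
      q ^ V.length * g (U ++ false :: V) +
        lam (U.length + V.length + 1) * ∑ i : Fin V.length,
          if V.get i = true then
            u ^ (V.length - 1 - (V.take i.val).count false - (V.drop (i.val + 1)).length) *
              q ^ ((V.take i.val).count false + (V.drop (i.val + 1)).length) *
              (g (U ++ (V.take i.val ++ true :: V.drop (i.val + 1))) +
                g (U ++ (V.take i.val ++ false :: V.drop (i.val + 1))))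
          else 0 := by
  induction V generalizing U with
  | nil => simp
  | cons a V ih =>
    have hc : V.count false ≤ V.length := List.count_le_length
    have hi : ∀ i : Fin V.length,
        (V.take i.val).count false + (V.drop (i.val + 1)).length + 1 ≤ V.length := fun i => by
      have h₁ : (V.take i.val).count false ≤ (V.take i.val).length := List.count_le_length
      have h₂ := i.isLt
      rw [List.length_take] at h₁
      rw [List.length_drop]
      omega
    have ih' := ih (U ++ [a])
    cases a
    · rw [show (U ++ [false]).length + V.length + 1 = U.length + V.length + 2 by simp; omega] at ih'
      rw [show U.length + (false :: V).length + 1 = U.length + V.length + 2 by simp; omega]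
      have hs : ∀ i : Fin V.length,
          V.length - ((V.take i.val).count false + 1) = V.length - 1 - (V.take i.val).count false :=
        fun i => by omega
      simp only [List.length_cons, Fin.sum_univ_succ, List.get_cons_zero, List.get_cons_succ',
        Fin.val_zero, Fin.val_succ, List.take_zero, List.take_succ_cons, List.drop_succ_cons,
        List.drop_zero, List.count_cons_self, List.cons_append, List.nil_append,
        Bool.false_eq_true, List.append_assoc, if_false, Nat.add_sub_cancel,
        Nat.add_sub_add_right, hs, zero_add] at ih' ⊢
      have key : ∀ i : Fin V.length, ∀ x : R,
          (if V.get i = true then u ^ (V.length - 1 - (V.take i.val).count false -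
              (V.drop (i.val + 1)).length) *
            q ^ ((V.take i.val).count false + 1 + (V.drop (i.val + 1)).length) * x else 0) =
          q * (if V.get i = true then u ^ (V.length - 1 - (V.take i.val).count false -
              (V.drop (i.val + 1)).length) *
            q ^ ((V.take i.val).count false + (V.drop (i.val + 1)).length) * x else 0) :=
        fun i x => by split_ifs <;> ring
      simp only [key, ← Finset.mul_sum]
      linear_combination q * ih'
    · have h' := h U V
      rw [show (U ++ [true]).length + V.length + 1 = U.length + V.length + 2 by simp; omega] at ih'
      rw [show U.length + (true :: V).length + 1 = U.length + V.length + 2 by simp; omega]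
      have hs : ∀ i : Fin V.length,
          V.length - (V.take i.val).count false - (V.drop (i.val + 1)).length =
          (V.length - 1 - (V.take i.val).count false - (V.drop (i.val + 1)).length) + 1 :=
        fun i => by
          have := hi i
          omega
      have hs' : V.length + 1 - V.count false = V.length - V.count false + 1 := by omega
      have ht : ∀ l : List Bool, (true :: l).count false = l.count false := by simp
      simp only [List.length_cons, Fin.sum_univ_succ, List.get_cons_zero, List.get_cons_succ',
        Fin.val_zero, Fin.val_succ, List.take_zero, List.take_succ_cons, List.drop_succ_cons,
        List.drop_zero, ht, List.cons_append, List.nil_append, List.count_nil, Nat.sub_zero,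
        Nat.sub_self, List.append_assoc, if_true, Nat.add_sub_cancel, hs, hs', zero_add,
        pow_zero, one_mul] at ih' ⊢
      have key : ∀ i : Fin V.length, ∀ x : R,
          (if V.get i = true then u ^ (V.length - 1 - (V.take i.val).count false -
              (V.drop (i.val + 1)).length + 1) *
            q ^ ((V.take i.val).count false + (V.drop (i.val + 1)).length) * x else 0) =
          u * (if V.get i = true then u ^ (V.length - 1 - (V.take i.val).count false -
              (V.drop (i.val + 1)).length) *
            q ^ ((V.take i.val).count false + (V.drop (i.val + 1)).length) * x else 0) :=
        fun i x => by split_ifs <;> ring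
      simp only [key, ← Finset.mul_sum]
      linear_combination u * ih' + q ^ V.length * h'

end Transport

/-- every solution of the matrix ansatz system for `λ` satisfies the global
recurrence (2.2) for `g(•X)`. -/
theorem statement1 (lam : ℕ → K6) (g : List Bool → K6) (hg : IsSolution lam g) :
    GlobalRecBlack lam g := by
  obtain ⟨h₁, h₂, h₃, -⟩ := hg
  intro Y
  have hb := move_black_right h₁ [] Y
  have hw := move_white_left h₁ [] Y
  simp only [List.nil_append, List.length_nil, zero_add] at hb hw
  change _ = _ + _ * sumWhite g Y at hb
  change _ = _ + _ * sumBlack g Y at hw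
  rw [div_mul_eq_mul_div, eq_div_iff (denominator_ne_zero _)]
  linear_combination va * vb * hb +
    va * vu ^ (Y.length - Y.count false) * vq ^ Y.count false * h₃ Y +
    va * vd * hw + vd * vq ^ Y.length * h₂ Y
end
end

section
/- For every sequence λ = (λ_n)_{n≥0} of elements of K, every solution g of the matrix ansatz system for λ satisfies, for every word X of length n, the identity g(∘X) = (λ_{n+1}/(u^n·α·β − q^n·γ·δ))·[ γ·δ·Σ_{X=U•V} u^{n−1−|∘(U)|−|V|}·q^{|∘(U)|+|V|}·(g(U•V)+g(U∘V)) + u^{n−|∘(X)|}·q^{|∘(X)|}·γ·g(X) + γ·β·Σ_{X=U∘V} u^{n−1−|∘(U)|}·q^{|∘(U)|}·(g(U•V)+g(U∘V)) + u^n·β·g(X) ], where the sums range over all decompositions of X as a concatenation U•V (respectively U∘V). -/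
open MvPolynomial Finset

noncomputable section

/-- The exchange relation for the words of length `n + 1`, with coefficient `L`. -/
def LocalRel (L : K6) (n : ℕ) (h : List Bool → K6) : Prop :=
  ∀ U V : List Bool, U.length + V.length + 1 = n →
    vu * h (U ++ true :: false :: V) =
      vq * h (U ++ false :: true :: V) + L * (h (U ++ true :: V) + h (U ++ false :: V))

theorem LocalRel.cons {L : K6} {n : ℕ} {h : List Bool → K6} (H : LocalRel L (n + 1) h)
    (b : Bool) : LocalRel L n (fun W => h (b :: W)) := by
  intro U V hUV
  exact H (b :: U) V (by simp only [List.length_cons]; omega)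

theorem sumWhite_cons_true (h : List Bool → K6) (X : List Bool) :
    sumWhite h (true :: X) = vu * sumWhite (fun W => h (true :: W)) X := by
  unfold sumWhite
  rw [Finset.mul_sum]
  simp only [List.length_cons]
  rw [Fin.sum_univ_succ]
  simp only [List.get_cons_zero, Bool.true_eq_false, if_false, zero_add]
  refine Finset.sum_congr rfl fun i _ => ?_
  have hk : (X.take i.val).count false ≤ i.val :=
    List.count_le_length.trans (List.length_take_le _ _)
  have hi := i.isLt
  have e : X.length + 1 - 1 - (X.take i.val).count false =
      (X.length - 1 - (X.take i.val).count false) + 1 := by omega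
  simp only [List.get_cons_succ', Fin.val_succ, List.take_succ_cons, List.drop_succ_cons,
    List.cons_append, List.count_cons_of_ne (show true ≠ false by decide), e, pow_succ, mul_ite,
    mul_zero]
  congr 1
  ring

theorem sumWhite_cons_false (h : List Bool → K6) (X : List Bool) :
    sumWhite h (false :: X) =
      vu ^ X.length * (h (true :: X) + h (false :: X)) +
        vq * sumWhite (fun W => h (false :: W)) X := by
  unfold sumWhite
  rw [Finset.mul_sum]
  simp only [List.length_cons]
  rw [Fin.sum_univ_succ]
  congr 1
  · simp
  refine Finset.sum_congr rfl fun i _ => ?_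
  have e : X.length + 1 - 1 - ((X.take i.val).count false + 1) =
      X.length - 1 - (X.take i.val).count false := by omega
  simp only [List.get_cons_succ', Fin.val_succ, List.take_succ_cons, List.drop_succ_cons,
    List.cons_append, List.count_cons_self, e, pow_succ, mul_ite, mul_zero]
  congr 1
  ring

theorem sumBlack_cons_true (h : List Bool → K6) (X : List Bool) :
    sumBlack h (true :: X) =
      vq ^ X.length * (h (true :: X) + h (false :: X)) +
        vu * sumBlack (fun W => h (true :: W)) X := by
  unfold sumBlack
  rw [Finset.mul_sum]
  simp only [List.length_cons]
  rw [Fin.sum_univ_succ]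
  congr 1
  · simp
  refine Finset.sum_congr rfl fun i _ => ?_
  have hk : (X.take i.val).count false ≤ i.val :=
    List.count_le_length.trans (List.length_take_le _ _)
  have hi := i.isLt
  have e : X.length + 1 - 1 - (X.take i.val).count false - (X.drop (i.val + 1)).length =
      (X.length - 1 - (X.take i.val).count false - (X.drop (i.val + 1)).length) + 1 := by
    rw [List.length_drop]
    omega
  simp only [List.get_cons_succ', Fin.val_succ, List.take_succ_cons, List.drop_succ_cons,
    List.cons_append, List.count_cons_of_ne (show true ≠ false by decide), e, pow_succ, mul_ite,
    mul_zero]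
  congr 1
  ring

theorem sumBlack_cons_false (h : List Bool → K6) (X : List Bool) :
    sumBlack h (false :: X) = vq * sumBlack (fun W => h (false :: W)) X := by
  unfold sumBlack
  rw [Finset.mul_sum]
  simp only [List.length_cons]
  rw [Fin.sum_univ_succ]
  simp only [List.get_cons_zero, Bool.false_eq_true, if_false, zero_add]
  refine Finset.sum_congr rfl fun i _ => ?_
  have e : X.length + 1 - 1 - ((X.take i.val).count false + 1) - (X.drop (i.val + 1)).length =
      X.length - 1 - (X.take i.val).count false - (X.drop (i.val + 1)).length := by omega
  simp only [List.get_cons_succ', Fin.val_succ, List.take_succ_cons, List.drop_succ_cons,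
    List.cons_append, List.count_cons_self, e, pow_add, pow_one, mul_ite, mul_zero]
  congr 1
  ring

/-- Moving `•` from the left end of a word to its right end. -/
theorem LocalRel.move_black {L : K6} (X : List Bool) :
    ∀ h : List Bool → K6, LocalRel L X.length h →
      vu ^ X.length * h (true :: X) =
        vu ^ (X.length - X.count false) * vq ^ X.count false * h (X ++ [true]) +
          L * sumWhite h X := by
  induction X with
  | nil => intro h _; simp [sumWhite]
  | cons b X ih =>
    intro h H
    have key := ih _ (H.cons b)
    cases b
    · have loc := H [] X (by simp)
      simp only [List.nil_append] at loc
      rw [sumWhite_cons_false]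
      simp only [List.length_cons, List.count_cons_self, Nat.add_sub_add_right, List.cons_append,
        pow_succ]
      linear_combination vu ^ X.length * loc + vq * key
    · have e : X.length + 1 - X.count false = (X.length - X.count false) + 1 :=
        Nat.sub_add_comm List.count_le_length
      rw [sumWhite_cons_true]
      simp only [List.length_cons, List.count_cons_of_ne (show true ≠ false by decide), e,
        List.cons_append, pow_succ]
      linear_combination vu * key

/-- Moving `∘` from the right end of a word to its left end. -/
theorem LocalRel.move_white {L : K6} (X : List Bool) :
    ∀ h : List Bool → K6, LocalRel L X.length h →
      vu ^ (X.length - X.count false) * vq ^ X.count false * h (X ++ [false]) =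
        vq ^ X.length * h (false :: X) + L * sumBlack h X := by
  induction X with
  | nil => intro h _; simp [sumBlack]
  | cons b X ih =>
    intro h H
    have key := ih _ (H.cons b)
    cases b
    · rw [sumBlack_cons_false]
      simp only [List.length_cons, List.count_cons_self, Nat.add_sub_add_right, List.cons_append,
        pow_succ]
      linear_combination vq * key
    · have loc := H [] X (by simp)
      simp only [List.nil_append] at loc
      have e : X.length + 1 - X.count false = (X.length - X.count false) + 1 :=
        Nat.sub_add_comm List.count_le_length
      rw [sumBlack_cons_true]
      simp only [List.length_cons, List.count_cons_of_ne (show true ≠ false by decide), e,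
        List.cons_append, pow_succ]
      linear_combination vq ^ X.length * loc + vu * key

/-- every solution of the matrix ansatz system for `λ` satisfies the global
recurrence (2.3) for `g(∘X)`. -/
theorem statement2 (lam : ℕ → K6) (g : List Bool → K6) (hg : IsSolution lam g) :
    GlobalRecWhite lam g := by
  obtain ⟨h1, h2, h3, -⟩ := hg
  intro Xl
  have H : LocalRel (lam (Xl.length + 1)) Xl.length g := by
    intro U V hUV
    rw [← hUV]
    exact h1 U V
  rw [div_mul_eq_mul_div, eq_div_iff (denominator_ne_zero _)]
  linear_combination vu ^ Xl.length * vb * h2 Xl + vb * vg * LocalRel.move_black Xl g H +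
    vg * (vu ^ (Xl.length - Xl.count false) * vq ^ Xl.count false) * h3 Xl +
    vg * vd * LocalRel.move_white Xl g H
end
end

section
/- For every word m of length n over {•,∘}, the polynomial w(m) ∈ ℚ[α,β,γ,δ,q,u] is homogeneous of total degree n(n+1)/2 and all of its coefficients are nonnegative. -/
open MvPolynomial Finset

noncomputable section

/-- `Σ_{X = U•V} u^{n−1−|∘(U)|−|V|} q^{|∘(U)|+|V|} (g(U•V)+g(U∘V))` in `ℚ[α,β,γ,δ,q,u]`. -/
def sumBlackP (g : List Bool → P6) (Xl : List Bool) : P6 :=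
  ∑ i : Fin Xl.length,
    if Xl.get i = true then
      (X 5 : P6) ^ (Xl.length - 1 - (Xl.take i.val).count false - (Xl.drop (i.val + 1)).length) *
        (X 4 : P6) ^ ((Xl.take i.val).count false + (Xl.drop (i.val + 1)).length) *
        (g (Xl.take i.val ++ true :: Xl.drop (i.val + 1)) +
          g (Xl.take i.val ++ false :: Xl.drop (i.val + 1)))
    else 0

/-- `Σ_{X = U∘V} u^{n−1−|∘(U)|} q^{|∘(U)|} (g(U•V)+g(U∘V))` in `ℚ[α,β,γ,δ,q,u]`. -/
def sumWhiteP (g : List Bool → P6) (Xl : List Bool) : P6 :=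
  ∑ i : Fin Xl.length,
    if Xl.get i = false then
      (X 5 : P6) ^ (Xl.length - 1 - (Xl.take i.val).count false) *
        (X 4 : P6) ^ ((Xl.take i.val).count false) *
        (g (Xl.take i.val ++ true :: Xl.drop (i.val + 1)) +
          g (Xl.take i.val ++ false :: Xl.drop (i.val + 1)))
    else 0

/-- Auxiliary function computing `w` for words of length at most the first argument. -/
def wAux : ℕ → List Bool → P6
  | 0, _ => 1
  | _ + 1, [] => 1
  | n + 1, b :: Yl =>
    if b then
      -- w(•X)
      X 0 * X 3 * sumBlackP (wAux n) Yl + (X 4 : P6) ^ Yl.length * X 3 * wAux n Yl +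
        (X 5 : P6) ^ (Yl.length - Yl.count false) * (X 4 : P6) ^ (Yl.count false) * X 0 *
          wAux n Yl +
        X 0 * X 1 * sumWhiteP (wAux n) Yl
    else
      -- w(∘X)
      X 2 * X 3 * sumBlackP (wAux n) Yl +
        (X 5 : P6) ^ (Yl.length - Yl.count false) * (X 4 : P6) ^ (Yl.count false) * X 2 *
          wAux n Yl +
        X 2 * X 1 * sumWhiteP (wAux n) Yl + (X 5 : P6) ^ Yl.length * X 1 * wAux n Yl

/-- The weight `w(m) ∈ ℚ[α,β,γ,δ,q,u]` of a word `m` over `{•,∘}` (`true` = `•`,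
head of the list = leftmost letter), defined by `w(ε) = 1` and the recurrences (2.2), (2.3)
specialised to `λ_{n+1} = u^n αβ − q^n γδ` (which cancels the denominator). -/
def w (m : List Bool) : P6 := wAux m.length m

/-- Homogeneous of degree `k` with nonnegative coefficients. -/
def IsNonnegHomogeneous (k : ℕ) (p : P6) : Prop :=
  p.IsHomogeneous k ∧ ∀ d : Fin 6 →₀ ℕ, 0 ≤ p.coeff d

namespace IsNonnegHomogeneous

theorem zero (k : ℕ) : IsNonnegHomogeneous k 0 :=
  ⟨isHomogeneous_zero _ _ _, fun d => by simp⟩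

theorem one : IsNonnegHomogeneous 0 1 :=
  ⟨isHomogeneous_one _ _, fun d => by
    rw [coeff_one]
    split_ifs <;> norm_num⟩

theorem X (i : Fin 6) : IsNonnegHomogeneous 1 (MvPolynomial.X i) :=
  ⟨isHomogeneous_X _ _, fun d => by
    rw [coeff_X]
    split_ifs <;> norm_num⟩

theorem add {k : ℕ} {p r : P6} (hp : IsNonnegHomogeneous k p) (hr : IsNonnegHomogeneous k r) :
    IsNonnegHomogeneous k (p + r) :=
  ⟨hp.1.add hr.1, fun d => by
    rw [coeff_add]
    exact add_nonneg (hp.2 d) (hr.2 d)⟩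

theorem mul {k l : ℕ} {p r : P6} (hp : IsNonnegHomogeneous k p) (hr : IsNonnegHomogeneous l r) :
    IsNonnegHomogeneous (k + l) (p * r) :=
  ⟨hp.1.mul hr.1, fun d => by
    rw [coeff_mul]
    exact Finset.sum_nonneg fun x _ => mul_nonneg (hp.2 _) (hr.2 _)⟩

theorem sum {ι : Type*} {k : ℕ} (s : Finset ι) {f : ι → P6}
    (hf : ∀ i ∈ s, IsNonnegHomogeneous k (f i)) : IsNonnegHomogeneous k (∑ i ∈ s, f i) :=
  Finset.sum_induction f (IsNonnegHomogeneous k) (fun _ _ => add) (zero k) hf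

theorem X_pow (i : Fin 6) (n : ℕ) : IsNonnegHomogeneous n ((MvPolynomial.X i : P6) ^ n) := by
  induction n with
  | zero => simpa using one
  | succ n ih => simpa only [pow_succ] using ih.mul (X i)

theorem of_eq {k l : ℕ} {p : P6} (hp : IsNonnegHomogeneous k p) (h : k = l) :
    IsNonnegHomogeneous l p :=
  h ▸ hp

variable {g : List Bool → P6} {Xl : List Bool} {k : ℕ}

theorem replace_letter
    (hg : ∀ Yl : List Bool, Yl.length = Xl.length → IsNonnegHomogeneous k (g Yl))
    (i : Fin Xl.length) :
    IsNonnegHomogeneous k (g (Xl.take i.val ++ true :: Xl.drop (i.val + 1)) +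
      g (Xl.take i.val ++ false :: Xl.drop (i.val + 1))) := by
  refine add (hg _ ?_) (hg _ ?_) <;>
  · have := i.isLt
    simp only [List.length_append, List.length_take, List.length_cons, List.length_drop]
    omega

theorem count_take_le (i : Fin Xl.length) : (Xl.take i.val).count false ≤ i.val :=
  List.count_le_length.trans (List.length_take_le _ _)

theorem sumBlack
    (hg : ∀ Yl : List Bool, Yl.length = Xl.length → IsNonnegHomogeneous k (g Yl)) :
    IsNonnegHomogeneous (Xl.length - 1 + k) (sumBlackP g Xl) := by
  refine sum _ fun i _ => ?_
  split_ifs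
  · refine (((X_pow _ _).mul (X_pow _ _)).mul (replace_letter hg i)).of_eq ?_
    have := i.isLt
    have := count_take_le i
    rw [List.length_drop]
    omega
  · exact zero _

theorem sumWhite
    (hg : ∀ Yl : List Bool, Yl.length = Xl.length → IsNonnegHomogeneous k (g Yl)) :
    IsNonnegHomogeneous (Xl.length - 1 + k) (sumWhiteP g Xl) := by
  refine sum _ fun i _ => ?_
  split_ifs
  · refine (((X_pow _ _).mul (X_pow _ _)).mul (replace_letter hg i)).of_eq ?_
    have := i.isLt
    have := count_take_le i
    omega
  · exact zero _

theorem mul_sumBlackP (a b : Fin 6)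
    (hg : ∀ Yl : List Bool, Yl.length = Xl.length → IsNonnegHomogeneous k (g Yl)) :
    IsNonnegHomogeneous (Xl.length + 1 + k)
      (MvPolynomial.X a * MvPolynomial.X b * sumBlackP g Xl) := by
  rcases Xl with _ | ⟨c, Zl⟩
  · simpa [sumBlackP] using zero _
  · refine (((X a).mul (X b)).mul (sumBlack hg)).of_eq ?_
    simp only [List.length_cons]
    omega

theorem mul_sumWhiteP (a b : Fin 6)
    (hg : ∀ Yl : List Bool, Yl.length = Xl.length → IsNonnegHomogeneous k (g Yl)) :
    IsNonnegHomogeneous (Xl.length + 1 + k)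
      (MvPolynomial.X a * MvPolynomial.X b * sumWhiteP g Xl) := by
  rcases Xl with _ | ⟨c, Zl⟩
  · simpa [sumWhiteP] using zero _
  · refine (((X a).mul (X b)).mul (sumWhite hg)).of_eq ?_
    simp only [List.length_cons]
    omega

theorem X_pow_length_mul (a b : Fin 6)
    (hg : ∀ Yl : List Bool, Yl.length = Xl.length → IsNonnegHomogeneous k (g Yl)) :
    IsNonnegHomogeneous (Xl.length + 1 + k)
      ((MvPolynomial.X a : P6) ^ Xl.length * MvPolynomial.X b * g Xl) :=
  ((X_pow _ _).mul (X _)).mul (hg Xl rfl)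

theorem X_pow_count_mul (a : Fin 6)
    (hg : ∀ Yl : List Bool, Yl.length = Xl.length → IsNonnegHomogeneous k (g Yl)) :
    IsNonnegHomogeneous (Xl.length + 1 + k)
      ((MvPolynomial.X 5 : P6) ^ (Xl.length - Xl.count false) *
        (MvPolynomial.X 4 : P6) ^ (Xl.count false) * MvPolynomial.X a * g Xl) := by
  refine ((((X_pow _ _).mul (X_pow _ _)).mul (X _)).mul (hg Xl rfl)).of_eq ?_
  have : Xl.count false ≤ Xl.length := List.count_le_length
  omega

end IsNonnegHomogeneous

theorem wAux_isNonnegHomogeneous (n : ℕ) (m : List Bool) (hm : m.length = n) :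
    IsNonnegHomogeneous (n * (n + 1) / 2) (wAux n m) := by
  induction n generalizing m with
  | zero => simpa [wAux] using IsNonnegHomogeneous.one
  | succ n ih =>
    rcases m with _ | ⟨b, Yl⟩
    · simp at hm
    · obtain rfl : Yl.length = n := by simpa using hm
      have hdeg : Yl.length + 1 + Yl.length * (Yl.length + 1) / 2 =
          (Yl.length + 1) * (Yl.length + 1 + 1) / 2 := by
        rw [show (Yl.length + 1) * (Yl.length + 1 + 1) =
          Yl.length * (Yl.length + 1) + (Yl.length + 1) * 2 by ring,
          Nat.add_mul_div_right _ _ two_pos, add_comm]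
      rw [← hdeg, wAux]
      split_ifs
      · exact (((IsNonnegHomogeneous.mul_sumBlackP _ _ ih).add
          (IsNonnegHomogeneous.X_pow_length_mul _ _ ih)).add
          (IsNonnegHomogeneous.X_pow_count_mul _ ih)).add
          (IsNonnegHomogeneous.mul_sumWhiteP _ _ ih)
      · exact (((IsNonnegHomogeneous.mul_sumBlackP _ _ ih).add
          (IsNonnegHomogeneous.X_pow_count_mul _ ih)).add
          (IsNonnegHomogeneous.mul_sumWhiteP _ _ ih)).add
          (IsNonnegHomogeneous.X_pow_length_mul _ _ ih)

/-- for every word `m` of length `n`, `w(m)` is homogeneous of total degree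
`n(n+1)/2` and all its coefficients are nonnegative. -/
theorem statement5 (m : List Bool) :
    (w m).IsHomogeneous (m.length * (m.length + 1) / 2) ∧
      ∀ d : Fin 6 →₀ ℕ, 0 ≤ (w m).coeff d := by
  exact wAux_isNonnegHomogeneous _ m rfl
end
end

section
/- For every word m of length n over {•,∘}, the evaluation of w(m) at α = β = γ = δ = q = u = 1 equals 2^n·n!; consequently the evaluation of Z_{n,w} = Σ_{m ∈ {•,∘}^n} w(m) at α = β = γ = δ = q = u = 1 equals 4^n·n!. -/
open MvPolynomial Finset

noncomputable section

/-- The partition function `Z_{n,w} = Σ_{m ∈ {•,∘}^n} w(m)` (words of length `n` are encoded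
as functions `Fin n → Bool`, turned into lists via `List.ofFn`). -/
def Znw (n : ℕ) : P6 := ∑ f : Fin n → Bool, w (List.ofFn f)

theorem eval_sumBlackP_add_sumWhiteP (g : List Bool → P6) (c : ℚ) (Y : List Bool)
    (hg : ∀ Z : List Bool, Z.length = Y.length → eval (fun _ : Fin 6 => (1 : ℚ)) (g Z) = c) :
    eval (fun _ : Fin 6 => (1 : ℚ)) (sumBlackP g Y) +
      eval (fun _ : Fin 6 => (1 : ℚ)) (sumWhiteP g Y) = Y.length * (2 * c) := by
  have hlen (i : Fin Y.length) (b : Bool) :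
      (Y.take i.val ++ b :: Y.drop (i.val + 1)).length = Y.length := by
    simp only [List.length_append, List.length_take, List.length_cons, List.length_drop]
    omega
  rw [sumBlackP, sumWhiteP, map_sum, map_sum, ← Finset.sum_add_distrib,
    Finset.sum_congr rfl (g := fun _ => 2 * c)]
  · simp
  · intro i _
    have h := fun b => hg _ (hlen i b)
    cases hb : Y.get i <;>
      simp only [map_mul, map_add, map_pow, eval_X, one_pow, h, reduceCtorEq, if_true, if_false,
        map_zero] <;>
      ring

theorem eval_wAux_length (n : ℕ) (m : List Bool) (hm : m.length = n) :
    eval (fun _ : Fin 6 => (1 : ℚ)) (wAux n m) = 2 ^ n * (n.factorial : ℚ) := by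
  induction n generalizing m with
  | zero => simp [wAux]
  | succ n ih =>
    obtain _ | ⟨b, Y⟩ := m
    · simp at hm
    have hY : Y.length = n := by simpa using hm
    have hsum := eval_sumBlackP_add_sumWhiteP (wAux n) (2 ^ n * (n.factorial : ℚ)) Y
      fun Z hZ => ih Z (hZ.trans hY)
    rw [hY] at hsum
    cases b <;>
      simp only [wAux, reduceCtorEq, if_true, if_false, map_mul, map_add, map_pow, eval_X, one_pow,
        ih Y hY, one_mul, Nat.factorial_succ, Nat.cast_mul, Nat.cast_add, Nat.cast_one] <;>
      linear_combination hsum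

/-- evaluating `w(m)` at `α = β = γ = δ = q = u = 1` gives `2^n n!` for every word
`m` of length `n`; consequently evaluating `Z_{n,w}` there gives `4^n n!`. -/
theorem statement6 :
    (∀ m : List Bool,
        eval (fun _ : Fin 6 => (1 : ℚ)) (w m) =
          (2 : ℚ) ^ m.length * (Nat.factorial m.length : ℚ)) ∧
    ∀ n : ℕ, eval (fun _ : Fin 6 => (1 : ℚ)) (Znw n) = (4 : ℚ) ^ n * (Nat.factorial n : ℚ) := by
  have hw (m : List Bool) : eval (fun _ : Fin 6 => (1 : ℚ)) (w m) =
      (2 : ℚ) ^ m.length * (Nat.factorial m.length : ℚ) :=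
    eval_wAux_length _ m rfl
  refine ⟨hw, fun n => ?_⟩
  rw [Znw, map_sum]
  simp only [hw, List.length_ofFn, sum_const, card_univ, Fintype.card_fun, Fintype.card_bool,
    Fintype.card_fin, nsmul_eq_mul, Nat.cast_pow, Nat.cast_ofNat]
  rw [← mul_assoc, ← mul_pow]
  norm_num
end
end

section
/- For every n ≥ 0 and every word m of length n over {•,∘}, w(m) = Σ_T w(T), the sum over all staircase tableaux T of size n whose type is m. -/
open MvPolynomial Finset

noncomputable section

/-- A staircase tableau of size `n` is an assignment, to each cell `(i,j)` with `j ≤ i`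
(indices `0`-based here, rows numbered bottom to top, columns left to right), of either the
empty label (`none`) or one of the four symbols `α,β,γ,δ` (`some 0, some 1, some 2, some 3`),
such that every diagonal cell is non-empty, the cells above an `α/γ` in its column are empty,
and the cells to the left of a `β/δ` in its row are empty.  Cells outside the staircase
(`i < j`) carry `none`. -/
def IsStaircase (n : ℕ) (T : Fin n → Fin n → Option (Fin 4)) : Prop :=
  (∀ i j : Fin n, i < j → T i j = none) ∧
  (∀ i : Fin n, T i i ≠ none) ∧
  (∀ i j i' : Fin n, j ≤ i → i < i' → (T i j = some 0 ∨ T i j = some 2) → T i' j = none) ∧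
  (∀ i j j' : Fin n, j' < j → j ≤ i → (T i j = some 1 ∨ T i j = some 3) → T i j' = none)

instance IsStaircase.decPred (n : ℕ) : DecidablePred (IsStaircase n) := fun _ =>
  @instDecidableAnd _ _ inferInstance
    (@instDecidableAnd _ _ inferInstance (@instDecidableAnd _ _ inferInstance inferInstance))

/-- The type of staircase tableaux of size `n`. -/
def StaircaseTableau (n : ℕ) : Type := {T : Fin n → Fin n → Option (Fin 4) // IsStaircase n T}

instance (n : ℕ) : Fintype (StaircaseTableau n) := Subtype.fintype _

/-- The label of the nearest non-empty cell to the right of the cell `(i,j)` in its row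
(`none` if there is no such cell). -/
def nearestRight (n : ℕ) (T : Fin n → Fin n → Option (Fin 4)) (i j : Fin n) :
    Option (Fin 4) :=
  if h : (univ.filter fun j' : Fin n => j < j' ∧ T i j' ≠ none).Nonempty then
    T i ((univ.filter fun j' : Fin n => j < j' ∧ T i j' ≠ none).min' h)
  else none

/-- The label of the nearest non-empty cell below the cell `(i,j)` in its column
(`none` if there is no such cell). -/
def nearestBelow (n : ℕ) (T : Fin n → Fin n → Option (Fin 4)) (i j : Fin n) :
    Option (Fin 4) :=
  if h : (univ.filter fun i' : Fin n => i' < i ∧ T i' j ≠ none).Nonempty then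
    T ((univ.filter fun i' : Fin n => i' < i ∧ T i' j ≠ none).max' h) j
  else none

/-- The condition for an empty cell to receive a `q` in the `q/u` filling: the nearest
non-empty cell to its right contains a `δ`, or the nearest non-empty cell to its right
contains an `α` or a `γ` and the nearest non-empty cell below it contains a `β` or a `γ`. -/
def QCell (n : ℕ) (T : Fin n → Fin n → Option (Fin 4)) (i j : Fin n) : Prop :=
  nearestRight n T i j = some 3 ∨
    ((nearestRight n T i j = some 0 ∨ nearestRight n T i j = some 2) ∧
      (nearestBelow n T i j = some 1 ∨ nearestBelow n T i j = some 2))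

instance (n : ℕ) (T : Fin n → Fin n → Option (Fin 4)) (i j : Fin n) :
    Decidable (QCell n T i j) := by
  unfold QCell; infer_instance

/-- The entry of the cell `(i,j)` after the `q/u` filling, as a monomial of
`ℚ[α,β,γ,δ,q,u]`: a labelled cell contributes its symbol, an empty cell contributes `q` or
`u` according to the filling rule. -/
def cellValue (n : ℕ) (T : Fin n → Fin n → Option (Fin 4)) (i j : Fin n) : P6 :=
  match T i j with
  | some s => X (Fin.castLE (by omega) s)
  | none => if QCell n T i j then X 4 else X 5

/-- The weight `w(T) ∈ ℚ[α,β,γ,δ,q,u]` of a staircase tableau: the product of the entries of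
all its cells after the `q/u` filling. -/
def wt {n : ℕ} (T : StaircaseTableau n) : P6 :=
  ∏ i : Fin n, ∏ j : Fin n, if j ≤ i then cellValue n T.1 i j else 1

/-- The type of a staircase tableau of size `n`: the word `m_n ⋯ m_1` (leftmost letter first)
with `m_i = •` (`true`) if the `i`-th diagonal cell contains `α` or `δ` and `m_i = ∘`
(`false`) if it contains `β` or `γ`. -/
def typeOf {n : ℕ} (T : StaircaseTableau n) : List Bool :=
  List.ofFn fun k : Fin n =>
    decide (T.1 k.rev k.rev = some 0 ∨ T.1 k.rev k.rev = some 3)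

/-- The generating polynomial `Z_n(α,β,γ,δ;q,u)` of staircase tableaux of size `n`. -/
def Zst (n : ℕ) : P6 := ∑ T : StaircaseTableau n, wt T

/-! ### The row transfer operator -/

/-- Whether an empty cell with nearest right label `h` and nearest label below `v` gets a `q`. -/
def GetsQ (h v : Option (Fin 4)) : Prop :=
  h = some 3 ∨ ((h = some 0 ∨ h = some 2) ∧ (v = some 1 ∨ v = some 2))

instance (h v : Option (Fin 4)) : Decidable (GetsQ h v) := by
  unfold GetsQ; infer_instance

/-- The variable attached to a symbol. -/
def symVar (s : Fin 4) : P6 := X (Fin.castLE (by omega) s)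

/-- The value of a cell with content `x`, nearest right label `h` and nearest label below `v`. -/
def cellWeight (h v x : Option (Fin 4)) : P6 :=
  match x with
  | some s => symVar s
  | none => if GetsQ h v then X 4 else X 5

/-- Whether a cell with content `x` is compatible with the nearest label `h` to its right and
the nearest label `v` below it. -/
def Allowed (h v x : Option (Fin 4)) : Prop :=
  x ≠ none → ¬ (v = some 0 ∨ v = some 2) ∧ ¬ (h = some 1 ∨ h = some 3)

instance (h v x : Option (Fin 4)) : Decidable (Allowed h v x) := by
  unfold Allowed; infer_instance

/-- The weighted sum of `f` over the results of adding a row on top of columns whose topmost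
labels are listed from right to left, `h` being the nearest label to the right of the row. -/
def rowSum : Option (Fin 4) → List (Option (Fin 4)) → (List (Option (Fin 4)) → P6) → P6
  | _, [], f => f []
  | h, v :: c, f => ∑ x : Option (Fin 4), if Allowed h v x then
      cellWeight h v x * rowSum (x.or h) c (fun c' => f (x.or v :: c')) else 0

/-- The weighted sum of `g` over the results of adding a new column together with a new row
whose diagonal cell has type `b`. -/
def hookSum (b : Bool) (g : List (Option (Fin 4)) → P6) (c : List (Option (Fin 4))) : P6 :=
  ∑ x : Fin 4, if decide (x = 0 ∨ x = 3) = b then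
    symVar x * rowSum (some x) c (fun c' => g (some x :: c')) else 0

/-- The weighted sum of `g` over the lists of topmost labels of the tableaux of a given type. -/
def topSum : List Bool → (List (Option (Fin 4)) → P6) → P6
  | [], g => g []
  | b :: m, g => topSum m (hookSum b g)

lemma rowSum_one (c f) : rowSum (some 1) c f = X 5 ^ c.length * f c := by
  induction c generalizing f with
  | nil => simp [rowSum]
  | cons v c ih =>
    simp [rowSum, Allowed, cellWeight, GetsQ, ih]; ring

lemma rowSum_three (c f) : rowSum (some 3) c f = X 4 ^ c.length * f c := by
  induction c generalizing f with
  | nil => simp [rowSum]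
  | cons v c ih =>
    simp [rowSum, Allowed, cellWeight, GetsQ, ih]; ring

lemma rowSum_two (c f) : rowSum (some 2) c f = rowSum (some 0) c f := by
  induction c generalizing f with
  | nil => simp [rowSum]
  | cons v c ih => simp [rowSum, Allowed, cellWeight, GetsQ, ih]

lemma rowSum_add (h c f g) :
    rowSum h c (fun c' => f c' + g c') = rowSum h c f + rowSum h c g := by
  induction c generalizing h f g with
  | nil => simp [rowSum]
  | cons v c ih =>
    simp only [rowSum, ih, ← Finset.sum_add_distrib]
    refine Finset.sum_congr rfl fun x _ => ?_
    split_ifs <;> ring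

lemma rowSum_length_mul (a : ℕ → P6) (h c f) :
    rowSum h c (fun c' => a c'.length * f c') = a c.length * rowSum h c f := by
  induction c generalizing h f a with
  | nil => simp [rowSum]
  | cons v c ih =>
    simp only [rowSum, Finset.mul_sum, List.length_cons]
    refine Finset.sum_congr rfl fun x _ => ?_
    rw [ih (fun k => a (k + 1))]
    split_ifs <;> ring

lemma rowSum_const_mul (a : P6) (h c f) :
    rowSum h c (fun c' => a * f c') = a * rowSum h c f :=
  rowSum_length_mul (fun _ => a) h c f

lemma hookSum_true (g c) : hookSum true g c =
    X 0 * rowSum (some 0) c (fun c' => g (some 0 :: c')) +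
      X 3 * (X 4 ^ c.length * g (some 3 :: c)) := by
  simp [hookSum, Fin.sum_univ_four, rowSum_three, symVar]

lemma hookSum_false (g c) : hookSum false g c =
    X 1 * (X 5 ^ c.length * g (some 1 :: c)) +
      X 2 * rowSum (some 0) c (fun c' => g (some 2 :: c')) := by
  simp [hookSum, Fin.sum_univ_four, rowSum_one, rowSum_two, symVar]

lemma rowSum_cons_zero (g c) : rowSum (some 0) (some 0 :: c) g =
    X 5 * rowSum (some 0) c (fun c' => g (some 0 :: c')) := by
  simp [rowSum, Allowed, cellWeight, GetsQ]

lemma rowSum_cons_two (g c) : rowSum (some 0) (some 2 :: c) g =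
    X 4 * rowSum (some 0) c (fun c' => g (some 2 :: c')) := by
  simp [rowSum, Allowed, cellWeight, GetsQ]

lemma rowSum_cons_one (g c) : rowSum (some 0) (some 1 :: c) g =
    X 4 * rowSum (some 0) c (fun c' => g (some 1 :: c')) +
      (hookSum true g c + hookSum false g c) := by
  simp [rowSum, Allowed, cellWeight, GetsQ, hookSum, Fin.sum_univ_four]
  ring

lemma rowSum_cons_three (g c) : rowSum (some 0) (some 3 :: c) g =
    X 5 * rowSum (some 0) c (fun c' => g (some 3 :: c')) +
      (hookSum true g c + hookSum false g c) := by
  simp [rowSum, Allowed, cellWeight, GetsQ, hookSum, Fin.sum_univ_four]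
  ring

/-- Commutation of the hook operator with the row operator, for a black diagonal cell. -/
lemma hookSum_true_rowSum (g c) : hookSum true (fun c' => rowSum (some 0) c' g) c =
    X 5 * rowSum (some 0) c (hookSum true g) +
      X 3 * (X 4 ^ c.length * (hookSum true g c + hookSum false g c)) := by
  have e : hookSum true g = fun c => X 0 * rowSum (some 0) c (fun c' => g (some 0 :: c')) +
      X 3 * (X 4 ^ c.length * g (some 3 :: c)) := funext fun c => hookSum_true g c
  rw [hookSum_true]
  simp only [rowSum_cons_zero, rowSum_cons_three, rowSum_const_mul]
  conv_rhs => enter [1]; rw [e]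
  rw [rowSum_add]
  simp only [rowSum_const_mul, rowSum_length_mul (fun k => X 4 ^ k)]
  ring

/-- Commutation of the hook operator with the row operator, for a white diagonal cell. -/
lemma hookSum_false_rowSum (g c) : hookSum false (fun c' => rowSum (some 0) c' g) c =
    X 4 * rowSum (some 0) c (hookSum false g) +
      X 1 * (X 5 ^ c.length * (hookSum true g c + hookSum false g c)) := by
  have e : hookSum false g = fun c => X 1 * (X 5 ^ c.length * g (some 1 :: c)) +
      X 2 * rowSum (some 0) c (fun c' => g (some 2 :: c')) := funext fun c => hookSum_false g c
  rw [hookSum_false]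
  simp only [rowSum_cons_one, rowSum_cons_two, rowSum_const_mul]
  conv_rhs => enter [1]; rw [e]
  rw [rowSum_add]
  simp only [rowSum_const_mul, rowSum_length_mul (fun k => X 5 ^ k)]
  ring

/-! ### The recurrence for `topSum` -/

lemma hookSum_add (b g g') :
    hookSum b (fun c => g c + g' c) = fun c => hookSum b g c + hookSum b g' c := by
  funext c
  simp only [hookSum, rowSum_add, ← Finset.sum_add_distrib]
  refine Finset.sum_congr rfl fun x _ => ?_
  split_ifs <;> ring

lemma hookSum_length_mul (a : ℕ → P6) (b g) :
    hookSum b (fun c => a c.length * g c) = fun c => a (c.length + 1) * hookSum b g c := by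
  funext c
  simp only [hookSum, Finset.mul_sum, List.length_cons, rowSum_length_mul (fun k => a (k + 1))]
  refine Finset.sum_congr rfl fun x _ => ?_
  split_ifs <;> ring

lemma topSum_add (m g g') : topSum m (fun c => g c + g' c) = topSum m g + topSum m g' := by
  induction m generalizing g g' with
  | nil => rfl
  | cons b m ih => rw [topSum, hookSum_add, ih]; rfl

lemma topSum_length_mul (a : ℕ → P6) (m g) :
    topSum m (fun c => a c.length * g c) = a m.length * topSum m g := by
  induction m generalizing g a with
  | nil => rfl
  | cons b m ih => rw [topSum, hookSum_length_mul, ih (fun k => a (k + 1))]; rfl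

lemma topSum_const_mul (a : P6) (m g) :
    topSum m (fun c => a * g c) = a * topSum m g :=
  topSum_length_mul (fun _ => a) m g

lemma sumBlackP_true (g : List Bool → P6) (m) : sumBlackP g (true :: m) =
    X 4 ^ m.length * (g (true :: m) + g (false :: m)) +
      X 5 * sumBlackP (fun m' => g (true :: m')) m := by
  simp only [sumBlackP]
  erw [Fin.sum_univ_succ]
  simp only [Finset.mul_sum]
  congr 1
  · simp
  · refine Finset.sum_congr rfl fun i _ => ?_
    have h1 := i.2
    have h2 : (m.take i).count false ≤ i :=
      List.count_le_length.trans (by simp)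
    have h3 : m.length - (m.take i).count false - (m.length - (i + 1)) =
        m.length - 1 - (m.take i).count false - (m.length - (i + 1)) + 1 := by omega
    simp only [List.get_eq_getElem, Fin.val_succ, List.getElem_cons_succ, List.take_succ_cons,
      List.drop_succ_cons, List.length_drop, List.length_cons, List.cons_append,
      Nat.add_sub_cancel]
    rw [List.count_cons_of_ne (by simp), h3, pow_succ]
    split_ifs <;> ring

lemma sumBlackP_false (g : List Bool → P6) (m) : sumBlackP g (false :: m) =
    X 4 * sumBlackP (fun m' => g (false :: m')) m := by
  simp only [sumBlackP]
  erw [Fin.sum_univ_succ]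
  simp only [Finset.mul_sum]
  rw [if_neg (by simp), zero_add]
  refine Finset.sum_congr rfl fun i _ => ?_
  simp only [List.get_eq_getElem, Fin.val_succ, List.getElem_cons_succ, List.take_succ_cons,
    List.drop_succ_cons, List.length_drop, List.length_cons, List.cons_append,
    Nat.add_sub_cancel, List.count_cons_self]
  have h3 : m.length - ((m.take i).count false + 1) - (m.length - (i + 1)) =
      m.length - 1 - (m.take i).count false - (m.length - (i + 1)) := by omega
  rw [h3]
  split_ifs <;> ring

lemma sumWhiteP_false (g : List Bool → P6) (m) : sumWhiteP g (false :: m) =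
    X 5 ^ m.length * (g (true :: m) + g (false :: m)) +
      X 4 * sumWhiteP (fun m' => g (false :: m')) m := by
  simp only [sumWhiteP]
  erw [Fin.sum_univ_succ]
  simp only [Finset.mul_sum]
  congr 1
  · simp
  · refine Finset.sum_congr rfl fun i _ => ?_
    simp only [List.get_eq_getElem, Fin.val_succ, List.getElem_cons_succ, List.take_succ_cons,
      List.drop_succ_cons, List.length_cons, List.cons_append,
      Nat.add_sub_cancel, List.count_cons_self]
    have h3 : m.length - ((m.take i).count false + 1) =
        m.length - 1 - (m.take i).count false := by omega
    rw [h3]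
    split_ifs <;> ring

lemma sumWhiteP_true (g : List Bool → P6) (m) : sumWhiteP g (true :: m) =
    X 5 * sumWhiteP (fun m' => g (true :: m')) m := by
  simp only [sumWhiteP]
  erw [Fin.sum_univ_succ]
  simp only [Finset.mul_sum]
  rw [if_neg (by simp), zero_add]
  refine Finset.sum_congr rfl fun i _ => ?_
  have h1 := i.2
  have h2 : (m.take i).count false ≤ i :=
    List.count_le_length.trans (by simp)
  have h3 : m.length - (m.take i).count false =
      m.length - 1 - (m.take i).count false + 1 := by omega
  simp only [List.get_eq_getElem, Fin.val_succ, List.getElem_cons_succ, List.take_succ_cons,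
    List.drop_succ_cons, List.length_cons, List.cons_append,
    Nat.add_sub_cancel]
  rw [List.count_cons_of_ne (by simp), h3, pow_succ]
  split_ifs <;> ring

/-- Adding an open row on top of the tableaux of type `m`. -/
lemma topSum_rowSum (m g) : topSum m (fun c => rowSum (some 0) c g) =
    X 3 * sumBlackP (fun m' => topSum m' g) m +
      X 5 ^ (m.length - m.count false) * X 4 ^ m.count false * topSum m g +
      X 1 * sumWhiteP (fun m' => topSum m' g) m := by
  induction m generalizing g with
  | nil => simp [topSum, rowSum, sumBlackP, sumWhiteP]
  | cons b m ih =>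
    cases b
    · rw [sumBlackP_false, sumWhiteP_false, topSum]
      rw [show hookSum false (fun c => rowSum (some 0) c g) = _ from
        funext (hookSum_false_rowSum g)]
      simp only [topSum_add, topSum_const_mul,
        topSum_length_mul (fun k => X 5 ^ k), ih, topSum, List.count_cons_self, List.length_cons,
        Nat.add_sub_add_right]
      ring
    · have h : m.length + 1 - m.count false = m.length - m.count false + 1 := by
        have : m.count false ≤ m.length := List.count_le_length
        omega
      rw [sumBlackP_true, sumWhiteP_true, topSum, List.count_cons_of_ne (by simp),
        List.length_cons, h]
      rw [show hookSum true (fun c => rowSum (some 0) c g) = _ from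
        funext (hookSum_true_rowSum g)]
      simp only [topSum_add, topSum_const_mul,
        topSum_length_mul (fun k => X 4 ^ k), ih, topSum]
      ring

lemma sumBlackP_congr {g g' : List Bool → P6} {m : List Bool}
    (h : ∀ m', m'.length = m.length → g m' = g' m') : sumBlackP g m = sumBlackP g' m := by
  refine Finset.sum_congr rfl fun i _ => ?_
  have := i.2
  rw [h _ (by simp; omega), h _ (by simp; omega)]

lemma sumWhiteP_congr {g g' : List Bool → P6} {m : List Bool}
    (h : ∀ m', m'.length = m.length → g m' = g' m') : sumWhiteP g m = sumWhiteP g' m := by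
  refine Finset.sum_congr rfl fun i _ => ?_
  have := i.2
  rw [h _ (by simp; omega), h _ (by simp; omega)]

lemma wAux_eq_topSum (n : ℕ) (m : List Bool) (h : m.length = n) :
    wAux n m = topSum m (fun _ => 1) := by
  induction n generalizing m with
  | zero => obtain rfl := List.length_eq_zero_iff.1 h; rfl
  | succ n ih =>
    obtain _ | ⟨b, m⟩ := m
    · simp at h
    have hm : m.length = n := by simpa using h
    have e : ∀ m' : List Bool, m'.length = m.length →
        wAux n m' = topSum m' (fun _ => 1) := fun m' h' => ih m' (h'.trans hm)
    have one : topSum m (fun c => X 4 ^ c.length * 1) = X 4 ^ m.length * topSum m fun _ => 1 :=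
      topSum_length_mul (fun k => X 4 ^ k) _ _
    have one' : topSum m (fun c => X 5 ^ c.length * 1) = X 5 ^ m.length * topSum m fun _ => 1 :=
      topSum_length_mul (fun k => X 5 ^ k) _ _
    rw [wAux, sumBlackP_congr e, sumWhiteP_congr e, e m rfl, topSum]
    cases b
    · rw [if_neg (by simp), show hookSum false (fun _ => 1) = _ from
        funext (hookSum_false fun _ => 1), topSum_add, topSum_const_mul, topSum_const_mul,
        topSum_rowSum, one']
      ring
    · rw [if_pos rfl, show hookSum true (fun _ => 1) = _ from
        funext (hookSum_true fun _ => 1), topSum_add, topSum_const_mul, topSum_const_mul,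
        topSum_rowSum, one]
      ring

/-! ### Nearest labels along a row and a column -/

/-- The nearest non-empty entry after position `j`, or `h` if there is none. -/
def nextLabel : {k : ℕ} → Option (Fin 4) → (Fin k → Option (Fin 4)) → Fin k → Option (Fin 4)
  | 0, _, _ => Fin.elim0
  | _ + 1, h, r => Fin.snoc (nextLabel ((r (Fin.last _)).or h) fun j => r j.castSucc) h

/-- The last non-empty entry. -/
def lastLabel : {k : ℕ} → (Fin k → Option (Fin 4)) → Option (Fin 4)
  | 0, _ => none
  | _ + 1, r => (r (Fin.last _)).or (lastLabel fun j => r j.castSucc)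

@[simp] lemma nextLabel_last {k : ℕ} (h) (r : Fin (k + 1) → Option (Fin 4)) :
    nextLabel h r (Fin.last k) = h := by
  simp [nextLabel]

@[simp] lemma nextLabel_castSucc {k : ℕ} (h) (r : Fin (k + 1) → Option (Fin 4)) (j : Fin k) :
    nextLabel h r j.castSucc =
      nextLabel ((r (Fin.last _)).or h) (fun j => r j.castSucc) j := by
  simp [nextLabel]

lemma nextLabel_of_forall {k : ℕ} (h) (r : Fin k → Option (Fin 4)) (j : Fin k)
    (hr : ∀ j', j < j' → r j' = none) : nextLabel h r j = h := by
  induction k generalizing h with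
  | zero => exact j.elim0
  | succ k ih =>
    induction j using Fin.lastCases with
    | last => simp
    | cast j =>
      rw [nextLabel_castSucc, ih _ _ _ fun j' hj' => hr _ (by simpa using hj'),
        hr _ (Fin.castSucc_lt_last j), Option.none_or]

lemma nextLabel_of_eq_some {k : ℕ} (h) (r : Fin k → Option (Fin 4)) (j j' : Fin k) (hj : j < j')
    (h0 : r j' ≠ none) (hr : ∀ i, j < i → i < j' → r i = none) : nextLabel h r j = r j' := by
  induction k generalizing h with
  | zero => exact j.elim0
  | succ k ih =>
    induction j using Fin.lastCases with
    | last => exact absurd hj (Fin.le_last j').not_gt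
    | cast j =>
      rw [nextLabel_castSucc]
      induction j' using Fin.lastCases with
      | last =>
        rw [nextLabel_of_forall _ _ _ fun i hi => hr _ (by simpa using hi)
          (Fin.castSucc_lt_last i)]
        obtain ⟨s, hs⟩ := Option.ne_none_iff_exists'.1 h0
        simp [hs]
      | cast j' =>
        exact ih _ (fun j => r j.castSucc) j j' (by simpa using hj) h0 fun i hi hi' =>
          hr _ (by simpa using hi) (by simpa using hi')

lemma lastLabel_of_forall {k : ℕ} (r : Fin k → Option (Fin 4)) (hr : ∀ j, r j = none) :
    lastLabel r = none := by
  induction k with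
  | zero => rfl
  | succ k ih => rw [lastLabel, hr, ih _ fun j => hr _]; rfl

lemma lastLabel_eq {k : ℕ} (r : Fin k → Option (Fin 4)) (j : Fin k) (h0 : r j ≠ none)
    (hr : ∀ i, j < i → r i = none) : lastLabel r = r j := by
  induction k with
  | zero => exact j.elim0
  | succ k ih =>
    rw [lastLabel]
    induction j using Fin.lastCases with
    | last =>
      obtain ⟨s, hs⟩ := Option.ne_none_iff_exists'.1 h0
      simp [hs]
    | cast j =>
      rw [hr _ (Fin.castSucc_lt_last j), Option.none_or]
      exact ih (fun j => r j.castSucc) j h0 fun i hi => hr _ (by simpa using hi)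

lemma nearestRight_eq (n : ℕ) (T : Fin n → Fin n → Option (Fin 4)) (i j : Fin n) :
    nearestRight n T i j = nextLabel none (T i) j := by
  unfold nearestRight
  split_ifs with h
  · have hm := Finset.min'_mem _ h
    have hle : ∀ x, _ → Finset.min' _ h ≤ x := fun x => Finset.min'_le _ x
    generalize Finset.min' _ h = a at *
    simp only [Finset.mem_filter, Finset.mem_univ, true_and] at hm hle
    refine (nextLabel_of_eq_some _ _ _ _ hm.1 hm.2 fun x hx hx' => ?_).symm
    by_contra h0
    exact absurd (hle x ⟨hx, h0⟩) hx'.not_ge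
  · rw [nextLabel_of_forall]
    intro x hx
    by_contra h0
    exact h ⟨x, by simpa using ⟨hx, h0⟩⟩

/-- The nearest label below is the last label of the part of the column below. -/
lemma nearestBelow_eq (n : ℕ) (T : Fin n → Fin n → Option (Fin 4)) (i j : Fin n) :
    nearestBelow n T i j =
      lastLabel fun i' : Fin i.val => T ⟨i', i'.2.trans i.2⟩ j := by
  unfold nearestBelow
  split_ifs with h
  · have hm := Finset.max'_mem _ h
    have hle : ∀ x, _ → x ≤ Finset.max' _ h := fun x => Finset.le_max' _ x
    generalize Finset.max' _ h = a at *
    simp only [Finset.mem_filter, Finset.mem_univ, true_and] at hm hle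
    refine (lastLabel_eq (fun i' : Fin i.val => T ⟨i', i'.2.trans i.2⟩ j) ⟨a, hm.1⟩ hm.2
      fun x hx => ?_).symm
    by_contra h0
    exact absurd (hle ⟨x, x.2.trans i.2⟩ ⟨x.2, h0⟩) (not_le.2 hx)
  · rw [lastLabel_of_forall]
    intro x
    by_contra h0
    exact h ⟨⟨x, x.2.trans i.2⟩, by simpa using ⟨x.2, h0⟩⟩

/-! ### Sums over the fillings of a row -/

/-- The entries of a tuple, listed from the last one to the first one. -/
def revList {α : Type*} {k : ℕ} (c : Fin k → α) : List α := List.ofFn fun i => c i.rev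

lemma revList_succ {α : Type*} {k : ℕ} (c : Fin (k + 1) → α) :
    revList c = c (Fin.last k) :: revList fun i => c i.castSucc := by
  simp [revList, List.ofFn_succ, Fin.rev_succ]

/-- Whether `r` is a valid row above columns with topmost labels `c` when `h` is the nearest
label to its right. -/
def RowValid {k : ℕ} (h : Option (Fin 4)) (c r : Fin k → Option (Fin 4)) : Prop :=
  (∀ j, (c j = some 0 ∨ c j = some 2) → r j = none) ∧
    (∀ j j', j' < j → (r j = some 1 ∨ r j = some 3) → r j' = none) ∧
    ((h = some 1 ∨ h = some 3) → ∀ j, r j = none)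

instance {k : ℕ} (h : Option (Fin 4)) (c r : Fin k → Option (Fin 4)) :
    Decidable (RowValid h c r) := by
  unfold RowValid; infer_instance

lemma rowValid_snoc {k : ℕ} (h x : Option (Fin 4)) (c : Fin (k + 1) → Option (Fin 4))
    (r : Fin k → Option (Fin 4)) :
    RowValid h c (Fin.snoc r x : Fin (k + 1) → Option (Fin 4)) ↔
      Allowed h (c (Fin.last k)) x ∧ RowValid (x.or h) (fun j => c j.castSucc) r := by
  simp only [RowValid, Allowed, Fin.forall_fin_succ', Fin.snoc_castSucc, Fin.snoc_last,
    Fin.castSucc_lt_castSucc_iff, Fin.castSucc_lt_last, lt_irrefl, (Fin.castSucc_lt_last _).not_gt]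
  cases x <;> grind

lemma sum_rowValid {k : ℕ} (h : Option (Fin 4)) (c : Fin k → Option (Fin 4))
    (f : List (Option (Fin 4)) → P6) :
    ∑ r : Fin k → Option (Fin 4), (if RowValid h c r then
      (∏ j, cellWeight (nextLabel h r j) (c j) (r j)) * f (revList fun j => (r j).or (c j))
      else 0) = rowSum h (revList c) f := by
  induction k generalizing h f with
  | zero => simp [RowValid, revList, rowSum]
  | succ k ih =>
    rw [revList_succ, rowSum, ← (Fin.snocEquiv fun _ => Option (Fin 4)).sum_comp,
      Fintype.sum_prod_type]
    refine Finset.sum_congr rfl fun x _ => ?_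
    rw [← ih]
    split_ifs with hx
    · rw [Finset.mul_sum]
      refine Finset.sum_congr rfl fun r _ => ?_
      simp only [Fin.snocEquiv, Equiv.coe_fn_mk, rowValid_snoc, hx, true_and, revList_succ,
        Fin.prod_univ_castSucc, nextLabel_castSucc, nextLabel_last, Fin.snoc_castSucc,
        Fin.snoc_last]
      split_ifs <;> ring
    · refine Finset.sum_eq_zero fun r _ => if_neg ?_
      simp [Fin.snocEquiv, rowValid_snoc, hx]

/-! ### Removing the top row of a staircase tableau -/

/-- The topmost labels of the columns. -/
def tops {n : ℕ} (T : Fin n → Fin n → Option (Fin 4)) (j : Fin n) : Option (Fin 4) :=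
  lastLabel fun i => T i j

/-- Add a row with diagonal entry `x` and remaining entries `r` on top of `T`. -/
def addRow {n : ℕ} (T : Fin n → Fin n → Option (Fin 4)) (x : Fin 4)
    (r : Fin n → Option (Fin 4)) : Fin (n + 1) → Fin (n + 1) → Option (Fin 4) :=
  Fin.snoc (fun i => (Fin.snoc (T i) none : Fin (n + 1) → Option (Fin 4)))
    (Fin.snoc r (some x) : Fin (n + 1) → Option (Fin 4))

section addRow

variable {n : ℕ} (T : Fin n → Fin n → Option (Fin 4)) (x : Fin 4) (r : Fin n → Option (Fin 4))

@[simp] lemma addRow_castSucc_castSucc (i j : Fin n) :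
    addRow T x r i.castSucc j.castSucc = T i j := by simp [addRow]

@[simp] lemma addRow_castSucc_last (i : Fin n) :
    addRow T x r i.castSucc (Fin.last n) = none := by simp [addRow]

@[simp] lemma addRow_last_castSucc (j : Fin n) :
    addRow T x r (Fin.last n) j.castSucc = r j := by simp [addRow]

@[simp] lemma addRow_last_last :
    addRow T x r (Fin.last n) (Fin.last n) = some x := by simp [addRow]

lemma tops_addRow_castSucc (j : Fin n) : tops (addRow T x r) j.castSucc = (r j).or (tops T j) := by
  simp [tops, lastLabel]

lemma tops_addRow_last : tops (addRow T x r) (Fin.last n) = some x := by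
  simp [tops, lastLabel]

variable {T x r}

/-- In a staircase tableau, a column contains an `α` or a `γ` iff its topmost label is one. -/
lemma tops_eq_iff (hT : IsStaircase n T) (j : Fin n) :
    (tops T j = some 0 ∨ tops T j = some 2) ↔ ∃ i, T i j = some 0 ∨ T i j = some 2 := by
  have key : ∀ i, (T i j = some 0 ∨ T i j = some 2) → tops T j = T i j := fun i hi => by
    have h0 : T i j ≠ none := by rcases hi with h | h <;> simp [h]
    refine lastLabel_eq (fun i => T i j) i h0 fun i' hi' => hT.2.2.1 i j i' ?_ hi' hi
    by_contra hlt
    exact h0 (hT.1 i j (not_le.1 hlt))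
  refine ⟨fun h => ?_, fun ⟨i, hi⟩ => by rwa [key i hi]⟩
  obtain ⟨i, hi⟩ : ∃ i, tops T j = T i j := by
    obtain ⟨i, hi, hmax⟩ := Finset.exists_max_image (univ.filter fun i => T i j ≠ none) id
      ⟨j, by simpa using hT.2.1 j⟩
    simp only [Finset.mem_filter, Finset.mem_univ, true_and, id] at hi hmax
    refine ⟨i, lastLabel_eq (fun i => T i j) i hi fun i' hi' => ?_⟩
    by_contra h0
    exact absurd (hmax i' h0) hi'.not_ge
  exact ⟨i, hi ▸ h⟩

lemma isStaircase_addRow_iff :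
    IsStaircase (n + 1) (addRow T x r) ↔
      IsStaircase n T ∧ RowValid (some x) (tops T) r := by
  have hcol (hT : IsStaircase n T) : (∀ j, (tops T j = some 0 ∨ tops T j = some 2) → r j = none) ↔
      ∀ i j : Fin n, j ≤ i → (T i j = some 0 ∨ T i j = some 2) → r j = none := by
    simp only [tops_eq_iff hT]
    refine ⟨fun h i j _ hi => h j ⟨i, hi⟩, fun h j ⟨i, hi⟩ => h i j ?_ hi⟩
    by_contra hlt
    simp [hT.1 i j (not_le.1 hlt)] at hi
  have split : IsStaircase (n + 1) (addRow T x r) ↔ IsStaircase n T ∧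
      (∀ i j : Fin n, j ≤ i → (T i j = some 0 ∨ T i j = some 2) → r j = none) ∧
      (∀ j j', j' < j → (r j = some 1 ∨ r j = some 3) → r j' = none) ∧
      ((some x = some 1 ∨ some x = some 3) → ∀ j, r j = none) := by
    simp only [IsStaircase, Fin.forall_fin_succ', addRow_castSucc_castSucc, addRow_castSucc_last,
      addRow_last_castSucc, addRow_last_last, Fin.castSucc_lt_castSucc_iff, Fin.castSucc_lt_last,
      Fin.castSucc_le_castSucc_iff, lt_irrefl, (Fin.castSucc_lt_last _).not_gt,
      (Fin.castSucc_lt_last _).not_ge, Fin.le_last]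
    grind
  rw [split]
  exact and_congr_right fun hT => by rw [← hcol hT]; rfl

end addRow

/-- A staircase tableau of size `n + 1` is one of size `n` together with a valid top row. -/
def topRowEquiv (n : ℕ) : (Σ T : StaircaseTableau n,
      {p : Fin 4 × (Fin n → Option (Fin 4)) // RowValid (some p.1) (tops T.1) p.2}) ≃
    StaircaseTableau (n + 1) :=
  Equiv.ofBijective
    (fun a => ⟨addRow a.1.1 a.2.1.1 a.2.1.2, isStaircase_addRow_iff.2 ⟨a.1.2, a.2.2⟩⟩) <| by
    constructor
    · rintro ⟨⟨T, hT⟩, ⟨x, r⟩, h⟩ ⟨⟨T', hT'⟩, ⟨x', r'⟩, h'⟩ e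
      have e' := congrArg Subtype.val e
      simp only at e'
      obtain rfl : T = T' := by
        funext i j
        simpa using congrFun (congrFun e' i.castSucc) j.castSucc
      obtain rfl : x = x' := by
        simpa using congrFun (congrFun e' (Fin.last n)) (Fin.last n)
      obtain rfl : r = r' := by
        funext j
        simpa using congrFun (congrFun e' (Fin.last n)) j.castSucc
      rfl
    · rintro ⟨T, hT⟩
      obtain ⟨x, hx⟩ := Option.ne_none_iff_exists'.1 (hT.2.1 (Fin.last n))
      have e : addRow (fun i j => T i.castSucc j.castSucc) x
          (fun j => T (Fin.last n) j.castSucc) = T := by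
        funext i j
        induction i using Fin.lastCases <;> induction j using Fin.lastCases <;>
          simp [hx, hT.1 _ _ (Fin.castSucc_lt_last _)]
      have h := isStaircase_addRow_iff.1 (e.symm ▸ hT)
      exact ⟨⟨⟨_, h.1⟩, ⟨(x, _), h.2⟩⟩, Subtype.ext e⟩

lemma cellValue_eq (n : ℕ) (T : Fin n → Fin n → Option (Fin 4)) (i j : Fin n) :
    cellValue n T i j = cellWeight (nearestRight n T i j) (nearestBelow n T i j) (T i j) := rfl

lemma wt_topRowEquiv {n : ℕ} (T : StaircaseTableau n)
    (p : {p : Fin 4 × (Fin n → Option (Fin 4)) // RowValid (some p.1) (tops T.1) p.2}) :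
    wt (topRowEquiv n ⟨T, p⟩) = wt T * (symVar p.1.1 *
      ∏ j, cellWeight (nextLabel (some p.1.1) p.1.2 j) (tops T.1 j) (p.1.2 j)) := by
  obtain ⟨⟨x, r⟩, hp⟩ := p
  have hR (i j : Fin n) : nearestRight (n + 1) (addRow T.1 x r) i.castSucc j.castSucc =
      nearestRight n T.1 i j := by
    simp [nearestRight_eq]
  have hB (i j : Fin n) : nearestBelow (n + 1) (addRow T.1 x r) i.castSucc j.castSucc =
      nearestBelow n T.1 i j := by
    rw [nearestBelow_eq, nearestBelow_eq]
    congr 1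
    funext i'
    exact addRow_castSucc_castSucc T.1 x r ⟨i', i'.2.trans i.2⟩ j
  have hR' (j : Fin n) : nearestRight (n + 1) (addRow T.1 x r) (Fin.last n) j.castSucc =
      nextLabel (some x) r j := by
    simp [nearestRight_eq]
  have hB' (j : Fin n) : nearestBelow (n + 1) (addRow T.1 x r) (Fin.last n) j.castSucc =
      tops T.1 j := by
    rw [nearestBelow_eq, tops]
    congr 1
    funext i'
    exact addRow_castSucc_castSucc T.1 x r i' j
  change (∏ i, ∏ j, if j ≤ i then cellValue (n + 1) (addRow T.1 x r) i j else 1) = _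
  simp only [wt, Fin.prod_univ_castSucc, cellValue_eq, hR, hB, hR', hB', addRow_castSucc_castSucc,
    addRow_last_castSucc, addRow_last_last, Fin.castSucc_le_castSucc_iff, Fin.le_last, if_true,
    (Fin.castSucc_lt_last _).not_ge, if_false, mul_one]
  simp only [cellWeight]
  ring

lemma typeOf_topRowEquiv {n : ℕ} (T : StaircaseTableau n)
    (p : {p : Fin 4 × (Fin n → Option (Fin 4)) // RowValid (some p.1) (tops T.1) p.2}) :
    typeOf (topRowEquiv n ⟨T, p⟩) = decide (p.1.1 = 0 ∨ p.1.1 = 3) :: typeOf T := by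
  obtain ⟨⟨x, r⟩, hp⟩ := p
  change (List.ofFn fun k : Fin (n + 1) => decide (addRow T.1 x r k.rev k.rev = some 0 ∨
    addRow T.1 x r k.rev k.rev = some 3)) = _
  simp [List.ofFn_succ, Fin.rev_succ, typeOf]

lemma revList_tops_topRowEquiv {n : ℕ} (T : StaircaseTableau n)
    (p : {p : Fin 4 × (Fin n → Option (Fin 4)) // RowValid (some p.1) (tops T.1) p.2}) :
    revList (tops (topRowEquiv n ⟨T, p⟩).1) =
      some p.1.1 :: revList fun j => (p.1.2 j).or (tops T.1 j) := by
  change revList (tops (addRow T.1 p.1.1 p.1.2)) = _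
  simp only [revList_succ, tops_addRow_last, tops_addRow_castSucc]

/-- The sum over tableaux of a given type is computed by `topSum`. -/
lemma sum_wt_mul_tops {n : ℕ} (m : List Bool) (hm : m.length = n)
    (g : List (Option (Fin 4)) → P6) :
    ∑ T : StaircaseTableau n, (if typeOf T = m then wt T * g (revList (tops T.1)) else 0) =
      topSum m g := by
  induction n generalizing m g with
  | zero =>
    obtain rfl := List.length_eq_zero_iff.1 hm
    have : Unique (StaircaseTableau 0) :=
      { default := ⟨fun i => i.elim0, by simp [IsStaircase]⟩
        uniq := fun T => Subtype.ext (funext fun i => i.elim0) }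
    rw [Fintype.sum_unique]
    simp [typeOf, wt, revList, topSum]
  | succ n ih =>
    obtain _ | ⟨b, m⟩ := m
    · simp at hm
    rw [topSum, ← ih m (by simpa using hm), ← (topRowEquiv n).sum_comp, Fintype.sum_sigma]
    refine Finset.sum_congr rfl fun T _ => ?_
    simp only [wt_topRowEquiv, typeOf_topRowEquiv, revList_tops_topRowEquiv, List.cons.injEq]
    split_ifs with hT
    · simp only [hT, and_true]
      rw [← Finset.sum_subtype (univ.filter fun p : Fin 4 × (Fin n → Option (Fin 4)) =>
          RowValid (some p.1) (tops T.1) p.2) (by simp) fun p =>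
          if decide (p.1 = 0 ∨ p.1 = 3) = b then wt T * (symVar p.1 *
            ∏ j, cellWeight (nextLabel (some p.1) p.2 j) (tops T.1 j) (p.2 j)) *
              g (some p.1 :: revList fun j => (p.2 j).or (tops T.1 j)) else 0,
        Finset.sum_filter, Fintype.sum_prod_type, hookSum, Finset.mul_sum]
      refine Finset.sum_congr rfl fun x _ => ?_
      rw [← sum_rowValid]
      split_ifs with hb
      · simp only [Finset.mul_sum]
        refine Finset.sum_congr rfl fun r _ => ?_
        split_ifs <;> ring
      · simp
    · simp [hT]

/-- for every word `m` of length `n`, `w(m)` is the sum of the weights of the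
staircase tableaux of size `n` of type `m`. -/
theorem statement9 (n : ℕ) (m : List Bool) (hm : m.length = n) :
    w m = ∑ T : StaircaseTableau n, if typeOf T = m then wt T else 0 := by
  rw [w, wAux_eq_topSum _ m rfl, ← sum_wt_mul_tops m hm]
  simp only [mul_one]
end
end

section
/- For every n ≥ 0, substituting α = 0 and δ = 0 in the generating polynomial Z_n(α,β,γ,δ;q,u) of staircase tableaux of size n yields the polynomial ∏_{i=0}^{n−1} ( u^i·β + β·γ·(Σ_{j=0}^{i−1} u^{i−1−j}·q^j) + q^i·γ ). -/
open MvPolynomial Finset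

noncomputable section

/-- The substitution `α = 0`, `δ = 0` (variables `0` and `3` are sent to `0`, the others are
kept). -/
def subAD : P6 →ₐ[ℚ] P6 := aeval (fun i : Fin 6 => if i.val = 0 ∨ i.val = 3 then 0 else X i)

/-- Row `i` contains a `β` or a `δ`. -/
def HasBetaDelta {n : ℕ} (T : Fin n → Fin n → Option (Fin 4)) (i : Fin n) : Prop :=
  ∃ j, T i j = some 1 ∨ T i j = some 3

/-- The image of a symbol under `α = δ = 0`. -/
def symbolValue (s : Fin 4) : P6 := if s = 1 then X 1 else if s = 2 then X 2 else 0

open Classical in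
/-- The entry of a cell after `α = δ = 0`: without `α` and `δ`, an empty cell carries a `u`
exactly when there is a `β` to its right. -/
def reducedValue {n : ℕ} (T : Fin n → Fin n → Option (Fin 4)) (i j : Fin n) : P6 :=
  match T i j with
  | some s => symbolValue s
  | none => if ∃ j', j < j' ∧ (T i j' = some 1 ∨ T i j' = some 3) then X 5 else X 4

/-- The weight of a tableau after `α = δ = 0`. -/
def reducedWeight {n : ℕ} (T : Fin n → Fin n → Option (Fin 4)) : P6 :=
  ∏ i : Fin n, ∏ j : Fin n, if j ≤ i then reducedValue T i j else 1

lemma subAD_X_castLE (s : Fin 4) (h : 4 ≤ 6) :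
    subAD (X (Fin.castLE h s)) = symbolValue s := by
  fin_cases s <;> simp [subAD, symbolValue]

lemma qCell_iff {n : ℕ} {T : Fin n → Fin n → Option (Fin 4)} (hT : IsStaircase n T)
    (hfree : ∀ i j, T i j ≠ some 0 ∧ T i j ≠ some 3) {i j : Fin n} (hij : j ≤ i)
    (hnone : T i j = none) :
    QCell n T i j ↔ ¬ ∃ j', j < j' ∧ (T i j' = some 1 ∨ T i j' = some 3) := by
  obtain ⟨hout, hdiag, -, hrow⟩ := hT
  have hlabel : ∀ i j, T i j ≠ none → T i j = some 1 ∨ T i j = some 2 := by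
    intro i j h
    have h' := hfree i j
    generalize T i j = x at h h'
    revert x
    decide
  have hlt : j < i := lt_of_le_of_ne hij fun h => hdiag i (h ▸ hnone)
  have hbelow : nearestBelow n T i j = some 1 ∨ nearestBelow n T i j = some 2 := by
    have hne : (univ.filter fun i' : Fin n => i' < i ∧ T i' j ≠ none).Nonempty :=
      ⟨j, by simpa using ⟨hlt, hdiag j⟩⟩
    rw [nearestBelow, dif_pos hne]
    exact hlabel _ _ (mem_filter.1 (max'_mem _ hne)).2.2
  have hne : (univ.filter fun j' : Fin n => j < j' ∧ T i j' ≠ none).Nonempty :=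
    ⟨i, by simpa using ⟨hlt, hdiag i⟩⟩
  have hright : nearestRight n T i j = T i (min' _ hne) := by rw [nearestRight, dif_pos hne]
  have hmem := (mem_filter.1 (min'_mem _ hne)).2
  have hmin : ∀ k, j < k → T i k ≠ none → min' _ hne ≤ k := fun k hk hk' =>
    min'_le _ k (by simpa using ⟨hk, hk'⟩)
  generalize min' _ hne = m at hright hmem hmin
  rw [QCell, hright]
  rcases hlabel _ _ hmem.2 with h | h
  · exact iff_of_false (by simp [h]) (not_not_intro ⟨m, hmem.1, Or.inl h⟩)
  · refine iff_of_true (Or.inr ⟨Or.inr h, hbelow⟩) ?_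
    rintro ⟨k, hjk, hk⟩
    have hkm : m ≤ k := hmin k hjk (by rcases hk with hk | hk <;> simp [hk])
    have hki : k ≤ i := by
      by_contra! hik
      rcases hk with hk | hk <;> simp [hout i k hik] at hk
    rcases hkm.lt_or_eq with hkm | rfl
    · exact hmem.2 (hrow i k m hkm hki hk)
    · rcases hk with hk | hk <;> simp [h] at hk

lemma subAD_wt {n : ℕ} (T : StaircaseTableau n) : subAD (wt T) = reducedWeight T.1 := by
  obtain ⟨T, hT⟩ := T
  have hsym : ∀ i j s, T i j = some s → subAD (cellValue n T i j) = symbolValue s ∧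
      reducedValue T i j = symbolValue s := by
    intro i j s h
    simp [cellValue, reducedValue, h, subAD_X_castLE]
  simp only [wt, reducedWeight, map_prod, apply_ite subAD, map_one]
  by_cases hfree : ∀ i j, T i j ≠ some 0 ∧ T i j ≠ some 3
  · refine prod_congr rfl fun i _ => prod_congr rfl fun j _ => ?_
    split_ifs with hij
    · rcases h : T i j with _ | s
      · have hq := qCell_iff hT hfree hij h
        simp only [cellValue, reducedValue, h, hq]
        split_ifs <;> simp [subAD]
      · rw [(hsym i j s h).1, (hsym i j s h).2]
    · rfl
  · obtain ⟨i, j, s, h, hs⟩ : ∃ i j s, T i j = some s ∧ symbolValue s = 0 := by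
      push Not at hfree
      obtain ⟨i, j, h⟩ := hfree
      by_cases h0 : T i j = some 0
      · exact ⟨i, j, 0, h0, by simp [symbolValue]⟩
      · exact ⟨i, j, 3, h h0, by simp [symbolValue]⟩
    have hij : j ≤ i := by
      by_contra! hij
      simp [hT.1 i j hij] at h
    trans 0
    · refine prod_eq_zero (mem_univ i) (prod_eq_zero (mem_univ j) ?_)
      rw [if_pos hij, (hsym i j s h).1, hs]
    · refine (prod_eq_zero (mem_univ i) (prod_eq_zero (mem_univ j) ?_)).symm
      rw [if_pos hij, (hsym i j s h).2, hs]

/-- Add the column `c` to the left of the tableau `T`. -/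
def addColumn {n : ℕ} (c : Fin (n + 1) → Option (Fin 4)) (T : Fin n → Fin n → Option (Fin 4)) :
    Fin (n + 1) → Fin (n + 1) → Option (Fin 4) :=
  fun i => Fin.cons (c i) fun j => Fin.cases none (fun i' => T i' j) i

section addColumn

variable {n : ℕ} (c : Fin (n + 1) → Option (Fin 4)) (T : Fin n → Fin n → Option (Fin 4))

@[simp] lemma addColumn_zero_right (i : Fin (n + 1)) : addColumn c T i 0 = c i := rfl

@[simp] lemma addColumn_zero_succ (j : Fin n) : addColumn c T 0 j.succ = none := rfl

@[simp] lemma addColumn_succ_succ (i j : Fin n) : addColumn c T i.succ j.succ = T i j := rfl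

end addColumn

/-- The cells above an `α` or a `γ` in the column `c` are empty. -/
def ColumnValid {m : ℕ} (c : Fin m → Option (Fin 4)) : Prop :=
  ∀ i i', i < i' → (c i = some 0 ∨ c i = some 2) → c i' = none

lemma columnValid_cons {m : ℕ} (x : Option (Fin 4)) (c : Fin m → Option (Fin 4)) :
    ColumnValid (Fin.cons x c : Fin (m + 1) → Option (Fin 4)) ↔
      ((x = some 0 ∨ x = some 2) → c = fun _ => none) ∧ ColumnValid c := by
  simp only [ColumnValid, Fin.forall_fin_succ, funext_iff]
  simp
  grind

/-- The column `c` can be added to the left of the tableau `T`. -/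
def Addable {n : ℕ} (T : Fin n → Fin n → Option (Fin 4)) (c : Fin (n + 1) → Option (Fin 4)) :
    Prop :=
  c 0 ≠ none ∧ ColumnValid c ∧ ∀ i : Fin n, HasBetaDelta T i → c i.succ = none

lemma isStaircase_addColumn {n : ℕ} (c : Fin (n + 1) → Option (Fin 4))
    (T : Fin n → Fin n → Option (Fin 4)) :
    IsStaircase (n + 1) (addColumn c T) ↔ IsStaircase n T ∧ Addable T c := by
  constructor
  · rintro ⟨hout, hdiag, hcol, hrow⟩
    have hout' : ∀ i j : Fin n, i < j → T i j = none := fun i j h =>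
      hout i.succ j.succ (Fin.succ_lt_succ_iff.2 h)
    refine ⟨⟨hout', fun i => hdiag i.succ, ?_, ?_⟩, hdiag 0, ?_, ?_⟩
    · exact fun i j i' h h' => hcol i.succ j.succ i'.succ (Fin.succ_le_succ_iff.2 h)
        (Fin.succ_lt_succ_iff.2 h')
    · exact fun i j j' h h' => hrow i.succ j.succ j'.succ (Fin.succ_lt_succ_iff.2 h)
        (Fin.succ_le_succ_iff.2 h')
    · exact fun i i' h => hcol i 0 i' (Fin.zero_le _) h
    · rintro i ⟨j, hj⟩
      have hji : j ≤ i := by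
        by_contra! h
        simp [hout' i j h] at hj
      exact hrow i.succ j.succ 0 (Fin.succ_pos j) (Fin.succ_le_succ_iff.2 hji) hj
  · rintro ⟨⟨hout, hdiag, hcol, hrow⟩, h0, hc, hB⟩
    refine ⟨?_, ?_, ?_, ?_⟩
    · intro i j h
      cases j using Fin.cases with
      | zero => simp at h
      | succ j =>
        cases i using Fin.cases with
        | zero => rfl
        | succ i => exact hout i j (Fin.succ_lt_succ_iff.1 h)
    · intro i
      cases i using Fin.cases with
      | zero => exact h0
      | succ i => exact hdiag i
    · intro i j i' h h'
      cases j using Fin.cases with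
      | zero => exact hc i i' h'
      | succ j =>
        cases i using Fin.cases with
        | zero => simp
        | succ i =>
          cases i' using Fin.cases with
          | zero => simp
          | succ i' => exact hcol i j i' (Fin.succ_le_succ_iff.1 h) (Fin.succ_lt_succ_iff.1 h')
    · intro i j j' h h'
      cases j using Fin.cases with
      | zero => simp at h
      | succ j =>
        cases i using Fin.cases with
        | zero => simp
        | succ i =>
          cases j' using Fin.cases with
          | zero => exact fun hj => hB i ⟨j, hj⟩
          | succ j' => exact hrow i j j' (Fin.succ_lt_succ_iff.1 h) (Fin.succ_le_succ_iff.1 h')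

/-- A staircase tableau of size `n + 1` is one of size `n` together with a leftmost column. -/
def tableauEquiv (n : ℕ) :
    StaircaseTableau (n + 1) ≃ (Σ T : StaircaseTableau n, {c // Addable T.1 c}) :=
  have key : ∀ T, IsStaircase (n + 1) T →
      addColumn (fun i => T i 0) (fun i j => T i.succ j.succ) = T := by
    intro T hT
    funext i j
    cases j using Fin.cases with
    | zero => rfl
    | succ j =>
      cases i using Fin.cases with
      | zero => exact (hT.1 0 j.succ (Fin.succ_pos j)).symm
      | succ i => rfl
  have key' : ∀ T, IsStaircase (n + 1) T → _ := fun T hT =>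
    (isStaircase_addColumn (fun i => T i 0) (fun i j => T i.succ j.succ)).1 ((key T hT).symm ▸ hT)
  { toFun := fun T => ⟨⟨_, (key' T.1 T.2).1⟩, ⟨_, (key' T.1 T.2).2⟩⟩
    invFun := fun p => ⟨addColumn p.2.1 p.1.1, (isStaircase_addColumn _ _).2 ⟨p.1.2, p.2.2⟩⟩
    left_inv := fun T => Subtype.ext (key T.1 T.2)
    right_inv := fun _ => rfl }

open Classical in
lemma sum_columnValid_succ {m : ℕ} (f : Fin (m + 1) → Option (Fin 4) → P6) :
    (∑ c, if ColumnValid c then ∏ i, f i (c i) else 0) =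
      (f 0 none + f 0 (some 1) + f 0 (some 3)) *
        (∑ c : Fin m → Option (Fin 4), if ColumnValid c then ∏ i, f i.succ (c i) else 0) +
      (f 0 (some 0) + f 0 (some 2)) * ∏ i : Fin m, f i.succ none := by
  have hnone : ColumnValid (fun _ : Fin m => (none : Option (Fin 4))) := fun _ _ _ _ => rfl
  have hsingle : ∀ x : P6, (∑ c : Fin m → Option (Fin 4),
      if (c = fun _ => none) ∧ ColumnValid c then x * ∏ i, f i.succ (c i) else 0) =
        x * ∏ i : Fin m, f i.succ none := by
    intro x
    rw [Finset.sum_eq_single (fun _ => none)]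
    · simp [hnone]
    · intro c _ hc
      simp [hc]
    · simp
  have hall : ∀ x : P6, (∑ c : Fin m → Option (Fin 4),
      if ColumnValid c then x * ∏ i, f i.succ (c i) else 0) =
        x * ∑ c : Fin m → Option (Fin 4), if ColumnValid c then ∏ i, f i.succ (c i) else 0 := by
    simp [mul_sum]
  have hcons : (∑ c, if ColumnValid c then ∏ i, f i (c i) else 0) =
      ∑ x, ∑ c : Fin m → Option (Fin 4),
        if ((x = some 0 ∨ x = some 2) → c = fun _ => none) ∧ ColumnValid c then
          f 0 x * ∏ i, f i.succ (c i) else 0 := by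
    rw [← Fintype.sum_prod_type']
    refine (Fintype.sum_equiv (Fin.consEquiv fun _ : Fin (m + 1) => Option (Fin 4)) _ _ ?_).symm
    rintro ⟨x, c⟩
    simp [Fin.consEquiv, columnValid_cons, Fin.prod_univ_succ]
  rw [hcons]
  simp [Fintype.sum_option, Fin.sum_univ_four, hsingle, hall, -mul_ite]
  ring

open Classical in
/-- The sum over the valid columns `c`; a single `α` or `γ` may end a column, and the contributions of
its possible positions telescope. -/
lemma sum_columnValid {m : ℕ} (B G : P6) (f : Fin m → Option (Fin 4) → P6)
    (h0 : ∀ i, f i (some 0) = 0) (h3 : ∀ i, f i (some 3) = 0)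
    (h12 : ∀ i, B * f i (some 2) = G * f i (some 1)) :
    B * (∑ c, if ColumnValid c then ∏ i, f i (c i) else 0) + G * ∏ i, f i none =
      (B + G) * ∏ i, (f i none + f i (some 1)) := by
  induction m with
  | zero => simp [ColumnValid]
  | succ m ih =>
    have ih := ih (fun i => f i.succ) (fun i => h0 _) (fun i => h3 _) (fun i => h12 _)
    have hsum := sum_columnValid_succ f
    simp only [Fin.prod_univ_succ (fun i => f i none),
      Fin.prod_univ_succ (fun i => f i none + f i (some 1)), h0, h3] at hsum ⊢
    rw [hsum]
    linear_combination (f 0 none + f 0 (some 1)) * ih +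
      (∏ i : Fin m, f i.succ none) * h12 0

open Classical in
/-- The product over the rows of `a` (rows with a `β` or a `δ`) and `b` (other rows). -/
def rowProduct {n : ℕ} (T : Fin n → Fin n → Option (Fin 4)) (a b : P6) : P6 :=
  ∏ i, if HasBetaDelta T i then a else b

/-- The generating polynomial at `α = δ = 0`, refined by the number of rows containing a `β`. -/
def refinedZ (n : ℕ) (a b : P6) : P6 :=
  ∑ T : StaircaseTableau n, reducedWeight T.1 * rowProduct T.1 a b

open Classical in
/-- The joint contribution of a cell of an added column and of its row, where `p` says whether
the rest of the row contains a `β` or a `δ`. -/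
def cellRowValue (a b : P6) (p : Prop) : Option (Fin 4) → P6
  | none => if p then X 5 * a else X 4 * b
  | some s => if p then 0 else if s = 1 then X 1 * a else if s = 2 then X 2 * b else 0

open Classical in
/-- The joint contribution of the bottom cell of an added column and of its row. -/
def bottomValue (a b : P6) : Option (Fin 4) → P6
  | none => 0
  | some s => if s = 1 then X 1 * a else if s = 2 then X 2 * b else 0

lemma reducedWeight_addColumn {n : ℕ} (c : Fin (n + 1) → Option (Fin 4))
    (T : Fin n → Fin n → Option (Fin 4)) :
    reducedWeight (addColumn c T) =
      reducedWeight T * ∏ i, reducedValue (addColumn c T) i 0 := by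
  have h : ∀ i j : Fin n, reducedValue (addColumn c T) i.succ j.succ = reducedValue T i j := by
    intro i j
    simp [reducedValue, Fin.exists_fin_succ]
  simp only [reducedWeight]
  rw [Fin.prod_univ_succ, Fin.prod_univ_succ]
  simp [Fin.prod_univ_succ (n := n), h, prod_mul_distrib, Fin.succ_ne_zero]
  ring

open Classical in
lemma reducedWeight_mul_rowProduct_addColumn {n : ℕ} {c : Fin (n + 1) → Option (Fin 4)}
    {T : Fin n → Fin n → Option (Fin 4)} (hc : Addable T c) (a b : P6) :
    reducedWeight (addColumn c T) * rowProduct (addColumn c T) a b =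
      reducedWeight T * (bottomValue a b (c 0) *
        ∏ i : Fin n, cellRowValue a b (HasBetaDelta T i) (c i.succ)) := by
  obtain ⟨h0, -, hB⟩ := hc
  rw [reducedWeight_addColumn, rowProduct, mul_assoc, ← prod_mul_distrib, Fin.prod_univ_succ]
  congr 2
  · obtain ⟨s, hs⟩ := Option.ne_none_iff_exists'.1 h0
    fin_cases s <;>
      simp [reducedValue, HasBetaDelta, Fin.exists_fin_succ, hs, symbolValue, bottomValue]
  · refine prod_congr rfl fun i _ => ?_
    have hB := hB i
    have hiff : HasBetaDelta (addColumn c T) i.succ ↔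
        (c i.succ = some 1 ∨ c i.succ = some 3) ∨ HasBetaDelta T i := by
      simp [HasBetaDelta, Fin.exists_fin_succ]
    have hex : (∃ j', 0 < j' ∧ (addColumn c T i.succ j' = some 1 ∨
        addColumn c T i.succ j' = some 3)) ↔ HasBetaDelta T i := by
      simp [HasBetaDelta, Fin.exists_fin_succ]
    simp only [reducedValue, hex, hiff, addColumn_zero_right]
    by_cases hp : HasBetaDelta T i
    · simp [hB hp, hp, cellRowValue]
    · rcases c i.succ with _ | s
      · simp [hp, cellRowValue]
      · fin_cases s <;> simp [hp, cellRowValue, symbolValue]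

open Classical in
lemma sum_addable {n : ℕ} (T : Fin n → Fin n → Option (Fin 4)) (a b : P6) :
    (∑ c : {c // Addable T c}, bottomValue a b (c.1 0) *
        ∏ i : Fin n, cellRowValue a b (HasBetaDelta T i) (c.1 i.succ)) =
      (X 1 * a + X 2 * b) * rowProduct T (X 5 * a) (X 4 * b + X 1 * a) := by
  let f : Fin (n + 1) → Option (Fin 4) → P6 :=
    Fin.cons (bottomValue a b) fun i => cellRowValue a b (HasBetaDelta T i)
  have hsum := sum_columnValid_succ f
  have htel := sum_columnValid (X 1 * a) (X 2 * b) (fun i : Fin n => f i.succ)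
    (by simp [f, cellRowValue]) (by simp [f, cellRowValue]) (by
      intro i
      simp only [f, Fin.cons_succ, cellRowValue]
      split_ifs <;> simp_all; ring)
  have hprod : (∏ i : Fin n, (f i.succ none + f i.succ (some 1))) =
      rowProduct T (X 5 * a) (X 4 * b + X 1 * a) := by
    refine prod_congr rfl fun i _ => ?_
    simp only [f, Fin.cons_succ, cellRowValue]
    split_ifs <;> simp_all
  have hsub : (∑ c : {c // Addable T c}, bottomValue a b (c.1 0) *
        ∏ i : Fin n, cellRowValue a b (HasBetaDelta T i) (c.1 i.succ)) =
      ∑ c, if ColumnValid c then ∏ i, f i (c i) else 0 := by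
    rw [← Finset.sum_subtype (univ.filter (Addable T)) (by simp) fun c =>
      bottomValue a b (c 0) * ∏ i : Fin n, cellRowValue a b (HasBetaDelta T i) (c i.succ),
      sum_filter]
    refine sum_congr rfl fun c _ => ?_
    rw [Fin.prod_univ_succ]
    simp only [f, Fin.cons_zero, Fin.cons_succ]
    by_cases hc : Addable T c
    · rw [if_pos hc, if_pos hc.2.1]
    · rw [if_neg hc, eq_comm, ite_eq_right_iff]
      intro hcol
      by_cases h0 : c 0 = none
      · simp [h0, bottomValue]
      · obtain ⟨i, hi, hci⟩ : ∃ i, HasBetaDelta T i ∧ c i.succ ≠ none := by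
          by_contra! h
          exact hc ⟨h0, hcol, h⟩
        obtain ⟨s, hs⟩ := Option.ne_none_iff_exists'.1 hci
        rw [prod_eq_zero (mem_univ i) (by simp [hs, hi, cellRowValue]), mul_zero]
  rw [hsub, hsum, ← hprod, ← htel]
  simp [f, bottomValue]

lemma refinedZ_succ (n : ℕ) (a b : P6) :
    refinedZ (n + 1) a b =
      (X 1 * a + X 2 * b) * refinedZ n (X 5 * a) (X 4 * b + X 1 * a) := by
  classical
  rw [refinedZ, ← (tableauEquiv n).symm.sum_comp, Fintype.sum_sigma, refinedZ, mul_sum]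
  refine sum_congr rfl fun T _ => ?_
  rw [mul_left_comm, ← sum_addable, mul_sum]
  exact sum_congr rfl fun c _ => reducedWeight_mul_rowProduct_addColumn c.2 a b

lemma refinedZ_eq_prod (n : ℕ) (a b : P6) :
    refinedZ n a b = ∏ i ∈ Finset.range n,
      ((X 5 : P6) ^ i * X 1 * a +
        X 1 * X 2 * a * ∑ j ∈ Finset.range i, (X 5 : P6) ^ (i - 1 - j) * (X 4 : P6) ^ j +
        (X 4 : P6) ^ i * X 2 * b) := by
  induction n generalizing a b with
  | zero =>
    have : Unique (StaircaseTableau 0) :=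
      ⟨⟨⟨fun i => i.elim0, by simp [IsStaircase]⟩⟩, fun T => Subtype.ext (Subsingleton.elim _ _)⟩
    simp [refinedZ, reducedWeight, rowProduct]
  | succ n ih =>
    rw [refinedZ_succ, ih, prod_range_succ', mul_comm]
    congr 1
    · refine prod_congr rfl fun i _ => ?_
      have h : ∑ j ∈ Finset.range (i + 1), (X 5 : P6) ^ (i + 1 - 1 - j) * (X 4 : P6) ^ j =
          X 5 * (∑ j ∈ Finset.range i, (X 5 : P6) ^ (i - 1 - j) * (X 4 : P6) ^ j) + X 4 ^ i := by
        rw [sum_range_succ, mul_sum]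
        congr 1
        · refine sum_congr rfl fun j hj => ?_
          have : i + 1 - 1 - j = (i - 1 - j) + 1 := by have := mem_range.1 hj; omega
          rw [this]
          ring
        · simp
      rw [h]
      ring
    · simp

/-- substituting `α = 0`, `δ = 0` in the generating polynomial
`Z_n(α,β,γ,δ;q,u)` of staircase tableaux of size `n` yields
`∏_{i=0}^{n−1} (u^i β + βγ(u^{i−1} + u^{i−2}q + ⋯ + q^{i−1}) + q^i γ)`. -/
theorem statement12 (n : ℕ) :
    subAD (Zst n) =
      ∏ i ∈ Finset.range n,
        ((X 5 : P6) ^ i * X 1 +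
          X 1 * X 2 * ∑ j ∈ Finset.range i, (X 5 : P6) ^ (i - 1 - j) * (X 4 : P6) ^ j +
          (X 4 : P6) ^ i * X 2) := by
  rw [Zst, map_sum]
  have h := refinedZ_eq_prod n 1 1
  simp only [refinedZ, rowProduct, ite_self, prod_const_one, mul_one] at h
  simpa only [subAD_wt] using h
end
end
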